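/- arXiv:1903.01146 — 9 statements merged into one kernel-verified Lean document; each statement's English description precedes it below -/
import Mathlib

section
/- The set NC(m) of non-crossing partitions of the linearly ordered set Fin m, partially ordered by refinement, is a lattice: every pair of non-crossing partitions has a greatest lower bound and a least upper bound within NC(m). Moreover, the greatest lower bound of two non-crossing partitions coincides with their greatest lower bound in the lattice of all partitions of Fin m. -/
open Finset

/-- A partition of `Fin m` (as a `Finpartition` of a finset of `Fin m`) is *non-crossing*
if there are no indices `a < b < c < d` such that `a` and `c` lie in one block while
`b` and `d` lie in a different block. -/
def IsNoncrossing {m : ℕ} {s : Finset (Fin m)} (P : Finpartition s) : Prop :=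
  ¬ ∃ a b c d : Fin m, a < b ∧ b < c ∧ c < d ∧
    ∃ B ∈ P.parts, ∃ B' ∈ P.parts, B ≠ B' ∧ a ∈ B ∧ c ∈ B ∧ b ∈ B' ∧ d ∈ B'

/-- The poset of non-crossing partitions of `Fin m`, ordered by refinement. -/
abbrev NC (m : ℕ) := {P : Finpartition (univ : Finset (Fin m)) // IsNoncrossing P}

theorem IsNoncrossing.inf {m : ℕ} {s : Finset (Fin m)} {P Q : Finpartition s}
    (hP : IsNoncrossing P) (hQ : IsNoncrossing Q) : IsNoncrossing (P ⊓ Q) := by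
  rintro ⟨a, b, c, d, hab, hbc, hcd, B, hB, B', hB', hne, haB, hcB, hbB', hdB'⟩
  have key : ∀ R : Finpartition s, IsNoncrossing R → P ⊓ Q ≤ R →
      ∃ C ∈ R.parts, B ⊆ C ∧ B' ⊆ C := by
    intro R hR hle
    obtain ⟨C, hC, hBC⟩ := hle hB
    obtain ⟨C', hC', hBC'⟩ := hle hB'
    by_cases h : C = C'
    · exact ⟨C, hC, hBC, h ▸ hBC'⟩
    · exact (hR ⟨a, b, c, d, hab, hbc, hcd, C, hC, C', hC', h,
        hBC haB, hBC hcB, hBC' hbB', hBC' hdB'⟩).elim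
  obtain ⟨C, hC, hBC, hBC'⟩ := key P hP inf_le_left
  obtain ⟨D, hD, hBD, hBD'⟩ := key Q hQ inf_le_right
  have hCD : C ∩ D ∈ (P ⊓ Q).parts := by
    rw [Finpartition.parts_inf, mem_erase, mem_image]
    exact ⟨ne_empty_of_mem (mem_inter.2 ⟨hBC haB, hBD haB⟩), (C, D), mem_product.2 ⟨hC, hD⟩, rfl⟩
  have h : B = C ∩ D :=
    (P ⊓ Q).eq_of_mem_parts hB hCD haB (mem_inter.2 ⟨hBC haB, hBD haB⟩)
  have h' : B' = C ∩ D :=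
    (P ⊓ Q).eq_of_mem_parts hB' hCD hbB' (mem_inter.2 ⟨hBC' hbB', hBD' hbB'⟩)
  exact hne (h.trans h'.symm)

theorem isNoncrossing_top {m : ℕ} {s : Finset (Fin m)} [Decidable (s = ⊥)] :
    IsNoncrossing (⊤ : Finpartition s) := by
  rintro ⟨a, b, c, d, -, -, -, B, hB, B', hB', hne, -⟩
  exact hne (Finpartition.parts_top_subsingleton s hB hB')

/-- `NC m` is a lattice: every pair of non-crossing partitions has a least upper bound and a
greatest lower bound within `NC m`; moreover the greatest lower bound coincides with the
one taken in the lattice of all partitions of `Fin m`. -/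
theorem NC.exists_isLUB_and_isGLB (m : ℕ) (p q : NC m) :
    (∃ j : NC m, IsLUB {p, q} j) ∧
    (∃ z : NC m, IsGLB {p, q} z ∧ z.val = p.val ⊓ q.val) := by
  classical
  constructor
  · let U : Finset (Finpartition (univ : Finset (Fin m))) :=
      {r | IsNoncrossing r ∧ p.val ≤ r ∧ q.val ≤ r}
    have hU : ∀ r, r ∈ U ↔ IsNoncrossing r ∧ p.val ≤ r ∧ q.val ≤ r := by simp [U]
    refine ⟨⟨U.inf id, inf_induction isNoncrossing_top (fun _ h _ h' => h.inf h')
      fun r hr => ((hU r).1 hr).1⟩, ?_, fun r hr => ?_⟩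
    · rintro r (rfl | rfl)
      · exact Finset.le_inf fun t ht => ((hU t).1 ht).2.1
      · exact Finset.le_inf fun t ht => ((hU t).1 ht).2.2
    · exact Finset.inf_le (f := id) ((hU r.val).2 ⟨r.property, hr (by simp), hr (by simp)⟩)
  · refine ⟨⟨p.val ⊓ q.val, p.property.inf q.property⟩, ⟨?_, fun r hr => ?_⟩, rfl⟩
    · rintro r (rfl | rfl)
      · exact inf_le_left (a := r.val)
      · exact inf_le_right (b := r.val)
    · have hrp : r.val ≤ p.val := hr (Set.mem_insert p {q})
      have hrq : r.val ≤ q.val := hr (Set.mem_insert_of_mem p rfl)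
      exact le_inf hrp hrq
end

section
/- For every natural number m, the number of non-crossing partitions of Fin m equals the m-th Catalan number C_m = (1/(m+1)) * choose(2m, m). -/
open Finset

/-- A setoid on `ℕ` is noncrossing on `[a, b)` if its classes do not cross and all numbers outside
`[a, b)` form singleton classes. -/
def IsNoncrossingOn (a b : ℕ) (r : Setoid ℕ) : Prop :=
  (∀ x y, r x y → x ≠ y → a ≤ x ∧ x < b) ∧
    ∀ w x y z, w < x → x < y → y < z → r w y → r x z → r w x

/-- Given a setoid `s` on `[a, c)` and a setoid `t` on `[c + 1, b)`, add `c` to the class of `a`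
in `s` (or leave it alone if `c = a`) and take the disjoint union with `t`. -/
def glueSetoid (a c b : ℕ) (s t : Setoid ℕ) (hs : IsNoncrossingOn a c s)
    (ht : IsNoncrossingOn (c + 1) b t) (hac : a ≤ c) : Setoid ℕ where
  r x y := s (if x = c then a else x) (if y = c then a else y) ∨ t x y
  iseqv :=
    { refl := fun x => Or.inl (s.refl' _)
      symm := fun h => h.imp s.symm' t.symm'
      trans := by
        intro x y z hxy hyz
        have h1 := hs.1
        have h2 := ht.1
        have := @s.trans'
        have := @t.trans'
        have := @s.symm'
        have := @t.symm'
        grind }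

theorem glueSetoid_apply {a c b : ℕ} {s t : Setoid ℕ} (hs : IsNoncrossingOn a c s)
    (ht : IsNoncrossingOn (c + 1) b t) (hac : a ≤ c) (x y : ℕ) :
    glueSetoid a c b s t hs ht hac x y ↔
      s (if x = c then a else x) (if y = c then a else y) ∨ t x y := Iff.rfl

theorem IsNoncrossingOn.glue {a c b : ℕ} {s t : Setoid ℕ} (hs : IsNoncrossingOn a c s)
    (ht : IsNoncrossingOn (c + 1) b t) (hac : a ≤ c) (hcb : c < b) :
    IsNoncrossingOn a b (glueSetoid a c b s t hs ht hac) := by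
  have h1 := hs.1
  have h2 := ht.1
  have := @s.symm'
  have := @t.symm'
  have := @s.trans'
  have := s.refl'
  have h3 := hs.2
  have h4 := ht.2
  refine ⟨fun x y => ?_, fun w x y z => ?_⟩
  · simp only [glueSetoid_apply]
    grind
  · simp only [glueSetoid_apply]
    grind

/-- The setoid that agrees with `r` on `[a, b)` and is trivial elsewhere. -/
def restrictSetoid (a b : ℕ) (r : Setoid ℕ) : Setoid ℕ where
  r x y := x = y ∨ r x y ∧ (a ≤ x ∧ x < b) ∧ a ≤ y ∧ y < b
  iseqv :=
    { refl := fun x => Or.inl rfl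
      symm := by
        have := @r.symm'
        grind
      trans := by
        have := @r.trans'
        grind }

theorem restrictSetoid_apply (a b : ℕ) (r : Setoid ℕ) (x y : ℕ) :
    restrictSetoid a b r x y ↔ x = y ∨ r x y ∧ (a ≤ x ∧ x < b) ∧ a ≤ y ∧ y < b := Iff.rfl

theorem IsNoncrossingOn.restrict {a b : ℕ} {r : Setoid ℕ} (hr : IsNoncrossingOn a b r)
    (a' b' : ℕ) : IsNoncrossingOn a' b' (restrictSetoid a' b' r) := by
  have h := hr.2
  refine ⟨fun x y => ?_, fun w x y z => ?_⟩
  · simp only [restrictSetoid_apply]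
    grind
  · simp only [restrictSetoid_apply]
    grind

/-- The gluing map, for all positions `a + k` of the last element in the class of `a`. -/
def glueMap (a n : ℕ)
    (p : Σ k : Fin (n + 1), {s : Setoid ℕ // IsNoncrossingOn a (a + k) s} ×
      {t : Setoid ℕ // IsNoncrossingOn (a + k + 1) (a + k + 1 + (n - k)) t}) :
    {r : Setoid ℕ // IsNoncrossingOn a (a + (n + 1)) r} :=
  ⟨glueSetoid a (a + p.1) _ p.2.1 p.2.2 p.2.1.2 p.2.2.2 (Nat.le_add_right _ _), by
    convert p.2.1.2.glue p.2.2.2 (Nat.le_add_right _ _) (by omega) using 1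
    omega⟩

theorem glueMap_apply {a n : ℕ} (k : Fin (n + 1))
    (s : {s : Setoid ℕ // IsNoncrossingOn a (a + k) s})
    (t : {t : Setoid ℕ // IsNoncrossingOn (a + k + 1) (a + k + 1 + (n - k)) t}) (x y : ℕ) :
    (glueMap a n ⟨k, s, t⟩).1 x y ↔
      s.1 (if x = a + k then a else x) (if y = a + k then a else y) ∨ t.1 x y := Iff.rfl

theorem glueMap_injective (a n : ℕ) : Function.Injective (glueMap a n) := by
  rintro ⟨k, s, t⟩ ⟨k', s', t'⟩ h
  have h' (x y : ℕ) : (glueMap a n ⟨k, s, t⟩).1 x y ↔ (glueMap a n ⟨k', s', t'⟩).1 x y := by rw [h]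
  simp only [glueMap_apply] at h'
  have hk : k = k' := by
    have h1 := h' a (a + k)
    have h2 := h' a (a + k')
    have := s.2.1
    have := t.2.1
    have := s'.2.1
    have := t'.2.1
    have := s.1.refl'
    have := s'.1.refl'
    have := @s.1.symm'
    have := @t.1.symm'
    have := @s'.1.symm'
    have := @t'.1.symm'
    ext
    grind
  subst hk
  have hs : s = s' := by
    ext x y
    have := h' x y
    have := s.2.1 x y
    have := s.2.1 y x
    have := t.2.1 x y
    have := s'.2.1 x y
    have := s'.2.1 y x
    have := t'.2.1 x y
    have := s.1.refl' x
    have := s'.1.refl' x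
    have : s.1 x y → s.1 y x := s.1.symm'
    have : s'.1 x y → s'.1 y x := s'.1.symm'
    grind
  have ht : t = t' := by
    ext x y
    have := h' x y
    have := s.2.1 x y
    have := t.2.1 x y
    have := t.2.1 y x
    have := s'.2.1 x y
    have := t'.2.1 x y
    have := t'.2.1 y x
    have := t.1.refl' x
    have := t'.1.refl' x
    have : t.1 x y → t.1 y x := t.1.symm'
    have : t'.1 x y → t'.1 y x := t'.1.symm'
    grind
  rw [hs, ht]

theorem glueMap_surjective (a n : ℕ) : Function.Surjective (glueMap a n) := by
  classical
  rintro ⟨r, hr⟩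
  obtain ⟨k, hk, hmax⟩ : ∃ k : Fin (n + 1), r a (a + k) ∧ ∀ j : Fin (n + 1), r a (a + j) → j ≤ k := by
    obtain ⟨k, hk, hmax⟩ := ({k | r a (a + k)} : Finset (Fin (n + 1))).exists_max_image id
      ⟨0, by simp⟩
    exact ⟨k, by simpa using hk, by simpa using hmax⟩
  refine ⟨⟨k, ⟨_, hr.restrict _ _⟩, ⟨_, hr.restrict _ _⟩⟩, ?_⟩
  ext x y
  rw [glueMap_apply]
  simp only [restrictSetoid_apply]
  have hmax' (z : ℕ) (hz : r a z) : z ≤ a + k := by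
    by_contra! hlt
    have hz' := hr.1 z a (r.symm' hz) (by omega)
    have := Fin.le_def.1 (hmax ⟨z - a, by omega⟩ (by rwa [Nat.add_sub_cancel' hz'.1]))
    grind
  have hcross {u v : ℕ} (hu : u ≤ a + k) (hv : a + k < v) : ¬ r u v := by
    intro huv
    have hau := (hr.1 u v huv (by omega)).1
    have hav : ¬ r a v := fun h => by have := hmax' v h; omega
    have h1 : ¬ r a u := fun h => hav (r.trans' h huv)
    have h2 : u ≠ a := fun h => h1 (h ▸ r.refl' a)
    have h3 : u ≠ a + k := fun h => h1 (h ▸ hk)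
    exact h1 (hr.2 a u (a + k) v (by omega) (by omega) hv hk huv)
  have hmerge (z : ℕ) : r z (if z = a + k then a else z) := by
    split_ifs with h
    · exact h ▸ r.symm' hk
    · exact r.refl' z
  have hrel : r (if x = a + k then a else x) (if y = a + k then a else y) ↔ r x y :=
    ⟨fun h => r.trans' (hmerge x) (r.trans' h (r.symm' (hmerge y))),
      fun h => r.trans' (r.symm' (hmerge x)) (r.trans' h (hmerge y))⟩
  constructor
  · rintro ((h | ⟨h, -⟩) | rfl | ⟨h, -⟩)
    · exact hrel.1 (h ▸ r.refl' _)
    · exact hrel.1 h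
    · exact r.refl' _
    · exact h
  · intro h
    by_cases hxy : x = y
    · exact Or.inr (Or.inl hxy)
    have hx := hr.1 x y h hxy
    have hy := hr.1 y x (r.symm' h) (Ne.symm hxy)
    have h1 : x ≤ a + k → ¬ a + k < y := fun hx hy => hcross hx hy h
    have h2 : y ≤ a + k → ¬ a + k < x := fun hy hx => hcross hy hx (r.symm' h)
    by_cases hxk : x ≤ a + k
    · refine Or.inl (Or.inr ⟨hrel.2 h, ?_⟩)
      split_ifs <;> omega
    · exact Or.inr (Or.inr ⟨h, by omega⟩)

theorem finite_and_card_isNoncrossingOn (n : ℕ) : ∀ a : ℕ,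
    Finite {r : Setoid ℕ // IsNoncrossingOn a (a + n) r} ∧
      Nat.card {r : Setoid ℕ // IsNoncrossingOn a (a + n) r} = catalan n := by
  induction n using Nat.strong_induction_on with
  | _ n ih =>
    intro a
    cases n with
    | zero =>
      have : Unique {r : Setoid ℕ // IsNoncrossingOn a (a + 0) r} :=
        { default := ⟨⊥, by simp [IsNoncrossingOn]; omega⟩
          uniq := by
            rintro ⟨r, hr⟩
            ext x y
            have := hr.1 x y
            have := r.refl' x
            simp only [Setoid.bot_def]
            grind }
      exact ⟨inferInstance, by simp⟩
    | succ n =>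
      have e := Equiv.ofBijective _ ⟨glueMap_injective a n, glueMap_surjective a n⟩
      have h1 (k : Fin (n + 1)) := ih k k.2 a
      have h2 (k : Fin (n + 1)) := ih (n - k) (by omega) (a + k + 1)
      have (k : Fin (n + 1)) := (h1 k).1
      have (k : Fin (n + 1)) := (h2 k).1
      refine ⟨.of_equiv _ e, ?_⟩
      rw [← Nat.card_congr e, Nat.card_sigma, catalan_succ]
      simp only [Nat.card_prod, (h1 _).2, (h2 _).2]

/-- The setoid on `ℕ` whose nontrivial classes are the blocks of a partition of `Fin m`. -/
def Finpartition.natSetoid {m : ℕ} (P : Finpartition (univ : Finset (Fin m))) : Setoid ℕ where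
  r x y := x = y ∨ ∃ i j : Fin m, i = x ∧ j = y ∧ P.part i = P.part j
  iseqv :=
    { refl := fun x => Or.inl rfl
      symm := by grind
      trans := by
        rintro x y z (rfl | ⟨i, j, rfl, rfl, h⟩) (rfl | ⟨i', j', h', rfl, h''⟩)
        · simp
        · exact Or.inr ⟨i', j', h', rfl, h''⟩
        · exact Or.inr ⟨i, j, rfl, rfl, h⟩
        · rw [Fin.ext h'] at h''
          exact Or.inr ⟨i, j', rfl, rfl, h.trans h''⟩ }

theorem Finpartition.natSetoid_apply {m : ℕ} (P : Finpartition (univ : Finset (Fin m))) (x y : ℕ) :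
    P.natSetoid x y ↔ x = y ∨ ∃ i j : Fin m, i = x ∧ j = y ∧ P.part i = P.part j := Iff.rfl

theorem Finpartition.natSetoid_coe {m : ℕ} (P : Finpartition (univ : Finset (Fin m)))
    (i j : Fin m) : P.natSetoid i j ↔ P.part i = P.part j := by
  rw [natSetoid_apply]
  constructor
  · rintro (h | ⟨i', j', hi, hj, h⟩)
    · rw [Fin.ext h]
    · rwa [← Fin.ext hi, ← Fin.ext hj]
  · exact fun h => Or.inr ⟨i, j, rfl, rfl, h⟩

theorem Finpartition.natSetoid_injective (m : ℕ) :
    Function.Injective (natSetoid : Finpartition (univ : Finset (Fin m)) → Setoid ℕ) := by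
  intro P Q h
  have key (i : Fin m) : P.part i = Q.part i := by
    ext j
    rw [P.mem_part_iff_part_eq_part (mem_univ _) (mem_univ _),
      Q.mem_part_iff_part_eq_part (mem_univ _) (mem_univ _), ← natSetoid_coe, ← natSetoid_coe, h]
  ext B
  constructor
  · intro hB
    obtain ⟨i, hi⟩ := P.nonempty_of_mem_parts hB
    rw [← P.part_eq_of_mem hB hi, key]
    simp
  · intro hB
    obtain ⟨i, hi⟩ := Q.nonempty_of_mem_parts hB
    rw [← Q.part_eq_of_mem hB hi, ← key]
    simp

theorem Finpartition.isNoncrossingOn_natSetoid_iff {m : ℕ}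
    (P : Finpartition (univ : Finset (Fin m))) :
    IsNoncrossingOn 0 m P.natSetoid ↔ IsNoncrossing P := by
  constructor
  · rintro ⟨-, h⟩ ⟨a, b, c, d, hab, hbc, hcd, B, hB, B', hB', hne, ha, hc, hb, hd⟩
    have := h a b c d hab hbc hcd
    simp only [natSetoid_coe] at this
    rw [P.part_eq_of_mem hB ha, P.part_eq_of_mem hB hc, P.part_eq_of_mem hB' hb,
      P.part_eq_of_mem hB' hd] at this
    exact hne (this rfl rfl)
  · intro h
    refine ⟨fun x y hxy hne => ?_, fun w x y z hwx hxy hyz hwy hxz => ?_⟩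
    · obtain hxy | ⟨i, j, rfl, rfl, -⟩ := hxy
      · exact absurd hxy hne
      · simp
    · obtain hwy | ⟨a, c, rfl, rfl, hac⟩ := hwy
      · omega
      obtain hxz | ⟨b, d, rfl, rfl, hbd⟩ := hxz
      · omega
      rw [natSetoid_coe]
      by_contra hne
      refine h ⟨a, b, c, d, hwx, hxy, hyz, P.part a, ?_, P.part b, ?_, hne, ?_, ?_, ?_, ?_⟩
      · simp
      · simp
      · simp [P.mem_part_self]
      · simp [hac, P.mem_part_self]
      · simp [P.mem_part_self]
      · simp [hbd, P.mem_part_self]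

theorem Finpartition.exists_natSetoid_eq {m : ℕ} {r : Setoid ℕ} (hr : IsNoncrossingOn 0 m r) :
    ∃ P : Finpartition (univ : Finset (Fin m)), P.natSetoid = r := by
  classical
  refine ⟨ofSetoid (r.comap (Fin.val (n := m))), ?_⟩
  have key (i j : Fin m) : (ofSetoid (r.comap (Fin.val (n := m)))).natSetoid i j ↔ r i j := by
    rw [natSetoid_coe, ← mem_part_iff_part_eq_part _ (mem_univ _) (mem_univ _),
      mem_part_ofSetoid_iff_rel, Setoid.comap_rel]
    exact ⟨r.symm', r.symm'⟩
  ext x y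
  constructor
  · rintro (rfl | ⟨i, j, rfl, rfl, h⟩)
    · exact r.refl' _
    · rwa [← key, natSetoid_coe]
  · intro h
    by_cases hxy : x = y
    · exact Or.inl hxy
    · exact (key ⟨x, (hr.1 x y h hxy).2⟩ ⟨y, (hr.1 y x (r.symm' h) (Ne.symm hxy)).2⟩).2 h

/-- The number of non-crossing partitions of `Fin m` is the `m`-th Catalan number. -/
theorem card_noncrossing_eq_catalan (m : ℕ) :
    Nat.card {P : Finpartition (univ : Finset (Fin m)) // IsNoncrossing P} = catalan m := by
  have h := (finite_and_card_isNoncrossingOn m 0).2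
  rw [zero_add] at h
  rw [← h]
  refine Nat.card_congr (Equiv.ofBijective
    (fun P => ⟨P.1.natSetoid, P.1.isNoncrossingOn_natSetoid_iff.2 P.2⟩) ⟨?_, ?_⟩)
  · intro P Q hPQ
    exact Subtype.ext (Finpartition.natSetoid_injective m (congrArg Subtype.val hPQ))
  · rintro ⟨r, hr⟩
    obtain ⟨P, rfl⟩ := Finpartition.exists_natSetoid_eq hr
    exact ⟨⟨P, P.isNoncrossingOn_natSetoid_iff.1 hr⟩, rfl⟩
end

section
/- For m ≥ 1, the Möbius function of the poset NC(m) of non-crossing partitions of Fin m, ordered by refinement, satisfies μ(⊥, ⊤) = (−1)^{m−1} · C_{m−1}, where ⊥ is the partition into m singleton blocks, ⊤ is the partition with a single block, and C_{m−1} = (2m−2)!/((m−1)!·m!) is the (m−1)-st Catalan number. -/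
open Finset

open scoped Classical

noncomputable instance (m : ℕ) : Fintype (NC m) := Fintype.ofFinite _

noncomputable instance (m : ℕ) : LocallyFiniteOrder (NC m) :=
  Fintype.toLocallyFiniteOrder

/-- An order embedding whose range is a lower set preserves the Möbius function. -/
theorem mu_orderEmbedding {α β : Type*} [PartialOrder α] [PartialOrder β]
    [LocallyFiniteOrder α] [LocallyFiniteOrder β] [DecidableEq α] [DecidableEq β]
    [WellFoundedLT α] (e : α ↪o β)
    (he : IsLowerSet (Set.range e)) (a b : α) :
    IncidenceAlgebra.mu ℤ (e a) (e b) = IncidenceAlgebra.mu ℤ a b := by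
  induction b using WellFoundedLT.induction with
  | ind b ih =>
    rw [IncidenceAlgebra.mu_apply, IncidenceAlgebra.mu_apply]
    simp only [e.injective.eq_iff]
    split_ifs with hab
    · rfl
    have hIco : Ico (e a) (e b) = (Ico a b).map e.toEmbedding := by
      ext y
      simp only [mem_Ico, mem_map]
      constructor
      · rintro ⟨h1, h2⟩
        obtain ⟨x, rfl⟩ := he h2.le ⟨b, rfl⟩
        exact ⟨x, ⟨e.le_iff_le.1 h1, e.lt_iff_lt.1 h2⟩, rfl⟩
      · rintro ⟨x, ⟨h1, h2⟩, rfl⟩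
        exact ⟨e.le_iff_le.2 h1, e.lt_iff_lt.2 h2⟩
    rw [hIco, sum_map]
    exact congrArg _ (sum_congr rfl fun x hx => ih x (mem_Ico.1 hx).2)

/-- **Weisner's theorem**, phrased for a map `c` such that `c x` is the least element above `x`
satisfying `Q`. -/
theorem sum_mu_bot_fiber_eq_zero {P : Type*} [PartialOrder P] [Fintype P] [LocallyFiniteOrder P]
    [OrderBot P] [DecidableEq P] (Q : P → Prop) (hQ : ¬ Q ⊥) (c : P → P)
    (hc : ∀ x z, c x ≤ z ↔ x ≤ z ∧ Q z) (y : P) :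
    ∑ x with c x = y, IncidenceAlgebra.mu ℤ ⊥ x = 0 := by
  induction y using WellFoundedLT.induction with
  | ind y ih =>
    have htotal : ∑ x with c x ≤ y, IncidenceAlgebra.mu ℤ ⊥ x = 0 := by
      by_cases hy : Q y
      · have hne : (⊥ : P) ≠ y := by rintro rfl; exact hQ hy
        rw [← (IncidenceAlgebra.sum_Icc_mu_right (𝕜 := ℤ) ⊥ y).trans (if_neg hne)]
        refine sum_congr ?_ fun _ _ => rfl
        ext x
        simp [hc, hy]
      · rw [filter_false_of_mem, sum_empty]
        intro x _ h
        exact hy ((hc x y).1 h).2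
    have hsplit : ∑ x with c x ≤ y, IncidenceAlgebra.mu ℤ ⊥ x
        = ∑ z with z ≤ y, ∑ x with c x = z, IncidenceAlgebra.mu ℤ ⊥ x := by
      rw [← sum_fiberwise_of_maps_to (g := c) (t := univ.filter (· ≤ y))]
      · refine sum_congr rfl fun z hz => sum_congr ?_ fun _ _ => rfl
        ext x
        simp only [mem_filter, mem_univ, true_and] at hz ⊢
        exact ⟨fun h => h.2, fun h => ⟨h ▸ hz, h⟩⟩
      · intro x hx
        simpa using hx
    rw [hsplit, sum_eq_single_of_mem y (by simp)] at htotal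
    · exact htotal
    · intro z hz hne
      exact ih z (lt_of_le_of_ne (mem_filter.1 hz).2 hne)

/-- Non-crossing equivalence relations on a linear order, ordered by refinement. -/
abbrev NCSetoid (α : Type*) [LinearOrder α] :=
  {r : Setoid α // ∀ a b c d, a < b → b < c → c < d → r a c → r b d → r a b}

namespace NCSetoid

variable {α β : Type*} [LinearOrder α] [LinearOrder β]

instance : BoundedOrder (NCSetoid α) where
  bot := ⟨⊥, fun a _ c _ hab hbc _ hac _ => absurd (show a = c from hac) (hab.trans hbc).ne⟩
  bot_le r := show (⊥ : Setoid α) ≤ r.1 from bot_le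
  top := ⟨⊤, fun _ _ _ _ _ _ _ _ _ => trivial⟩
  le_top r := show r.1 ≤ (⊤ : Setoid α) from le_top

noncomputable instance [Finite α] : Fintype (NCSetoid α) :=
  have : Finite (Setoid α) :=
    Finite.of_injective (fun r : Setoid α => (r : α → α → Prop)) fun _ _ h =>
      Setoid.ext fun a b => iff_of_eq (congrFun (congrFun h a) b)
  Fintype.ofFinite _

noncomputable instance [Finite α] : LocallyFiniteOrder (NCSetoid α) :=
  Fintype.toLocallyFiniteOrder

theorem eq_top_iff_forall {r : NCSetoid α} : r = ⊤ ↔ ∀ a b, r.1 a b :=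
  ⟨by rintro rfl a b; trivial, fun h => top_unique fun a b _ => h a b⟩

/-- Pull-back along an order isomorphism. -/
def congr (e : α ≃o β) : NCSetoid α ↪o NCSetoid β where
  toFun r := ⟨r.1.comap e.symm, fun _ _ _ _ hab hbc hcd => r.2 _ _ _ _
    (e.symm.lt_iff_lt.2 hab) (e.symm.lt_iff_lt.2 hbc) (e.symm.lt_iff_lt.2 hcd)⟩
  inj' r s h := by
    refine Subtype.ext (Setoid.ext fun a b => ?_)
    have := congrArg (fun t : NCSetoid β => t.1 (e a) (e b)) h
    simpa [Setoid.comap_rel] using this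
  map_rel_iff' {r s} := by
    constructor
    · intro h a b hab
      have := @h (e a) (e b)
      simp only [Setoid.comap_rel, e.symm_apply_apply] at this
      exact this hab
    · intro h a b hab
      exact h hab

theorem congr_surjective (e : α ≃o β) : Function.Surjective (congr e) := fun r =>
  ⟨congr e.symm r, Subtype.ext (Setoid.ext fun a b => by
    change r.1 (e (e.symm a)) (e (e.symm b)) ↔ r.1 a b
    simp only [e.apply_symm_apply])⟩

theorem mu_bot_top_congr [Finite α] [Finite β] (e : α ≃o β) :
    IncidenceAlgebra.mu ℤ (⊥ : NCSetoid α) ⊤ = IncidenceAlgebra.mu ℤ (⊥ : NCSetoid β) ⊤ := by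
  have hbot : congr e ⊥ = ⊥ := by
    obtain ⟨r, hr⟩ := congr_surjective e ⊥
    exact bot_unique (hr ▸ (congr e).le_iff_le.2 bot_le)
  have htop : congr e ⊤ = ⊤ := by
    obtain ⟨r, hr⟩ := congr_surjective e ⊤
    exact top_unique (hr ▸ (congr e).le_iff_le.2 le_top)
  rw [← mu_orderEmbedding (congr e) _ ⊥ ⊤, hbot, htop]
  rw [(congr_surjective e).range_eq]
  exact isLowerSet_univ

/-- `NonCrossingPred p` says that the set `p` and its complement do not cross. -/
def NonCrossingPred (p : α → Prop) : Prop :=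
  ∀ a b c d, a < b → b < c → c < d → (p a ↔ p c) → (p b ↔ p d) → (p a ↔ p b)

/-- The relation with the two blocks `p` and `¬ p`. -/
def twoBlock {p : α → Prop} (hp : NonCrossingPred p) : NCSetoid α :=
  ⟨⟨fun a b => (p a ↔ p b), fun _ => Iff.rfl, Iff.symm, Iff.trans⟩, hp⟩

/-- Glue non-crossing relations on a set and on its complement. -/
def glue {p : α → Prop} (hp : NonCrossingPred p) (r : NCSetoid {a // p a})
    (s : NCSetoid {a // ¬ p a}) : NCSetoid α where
  val :=
    { r := fun a b => (∃ ha hb, r.1 ⟨a, ha⟩ ⟨b, hb⟩) ∨ ∃ ha hb, s.1 ⟨a, ha⟩ ⟨b, hb⟩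
      iseqv :=
        { refl := fun a => by
            by_cases ha : p a
            · exact Or.inl ⟨ha, ha, r.1.refl _⟩
            · exact Or.inr ⟨ha, ha, s.1.refl _⟩
          symm := by
            rintro a b (⟨ha, hb, h⟩ | ⟨ha, hb, h⟩)
            · exact Or.inl ⟨hb, ha, r.1.symm h⟩
            · exact Or.inr ⟨hb, ha, s.1.symm h⟩
          trans := by
            rintro a b c (⟨ha, hb, h⟩ | ⟨ha, hb, h⟩) (⟨hb', hc, h'⟩ | ⟨hb', hc, h'⟩)
            · exact Or.inl ⟨ha, hc, r.1.trans h h'⟩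
            · exact absurd hb hb'
            · exact absurd hb' hb
            · exact Or.inr ⟨ha, hc, s.1.trans h h'⟩ } }
  property := by
    rintro a b c d hab hbc hcd (⟨ha, hc, h⟩ | ⟨ha, hc, h⟩) (⟨hb, hd, h'⟩ | ⟨hb, hd, h'⟩)
    · exact Or.inl ⟨ha, hb, r.2 ⟨a, ha⟩ ⟨b, hb⟩ ⟨c, hc⟩ ⟨d, hd⟩ hab hbc hcd h h'⟩
    · exact absurd ((hp a b c d hab hbc hcd (iff_of_true ha hc) (iff_of_false hb hd)).1 ha) hb
    · exact absurd ((hp a b c d hab hbc hcd (iff_of_false ha hc) (iff_of_true hb hd)).2 hb) ha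
    · exact Or.inr ⟨ha, hb, s.2 ⟨a, ha⟩ ⟨b, hb⟩ ⟨c, hc⟩ ⟨d, hd⟩ hab hbc hcd h h'⟩

theorem glue_rel {p : α → Prop} (hp : NonCrossingPred p) (r : NCSetoid {a // p a})
    (s : NCSetoid {a // ¬ p a}) (a b : α) : (glue hp r s).1 a b ↔
      (∃ ha hb, r.1 ⟨a, ha⟩ ⟨b, hb⟩) ∨ ∃ ha hb, s.1 ⟨a, ha⟩ ⟨b, hb⟩ := Iff.rfl

theorem glue_le_glue_iff {p : α → Prop} (hp : NonCrossingPred p) {r r' : NCSetoid {a // p a}}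
    {s s' : NCSetoid {a // ¬ p a}} : glue hp r s ≤ glue hp r' s' ↔ r ≤ r' ∧ s ≤ s' := by
  constructor
  · intro h
    constructor
    · rintro ⟨a, ha⟩ ⟨b, hb⟩ hab
      rcases h (show (glue hp r s).1 a b from Or.inl ⟨ha, hb, hab⟩) with ⟨_, _, h'⟩ | ⟨ha', _⟩
      · exact h'
      · exact absurd ha ha'
    · rintro ⟨a, ha⟩ ⟨b, hb⟩ hab
      rcases h (show (glue hp r s).1 a b from Or.inr ⟨ha, hb, hab⟩) with ⟨ha', _⟩ | ⟨_, _, h'⟩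
      · exact absurd ha' ha
      · exact h'
  · rintro ⟨hr, hs⟩ a b (⟨ha, hb, hab⟩ | ⟨ha, hb, hab⟩)
    · exact Or.inl ⟨ha, hb, hr hab⟩
    · exact Or.inr ⟨ha, hb, hs hab⟩

/-- `glue` as an order embedding of the product. -/
def glueEmbedding {p : α → Prop} (hp : NonCrossingPred p) :
    NCSetoid {a // p a} × NCSetoid {a // ¬ p a} ↪o NCSetoid α :=
  OrderEmbedding.ofMapLEIff (fun rs => glue hp rs.1 rs.2) fun _ _ => glue_le_glue_iff hp

theorem glue_top {p : α → Prop} (hp : NonCrossingPred p) : glue hp ⊤ ⊤ = twoBlock hp := by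
  refine Subtype.ext (Setoid.ext fun a b => ?_)
  rw [glue_rel]
  change _ ↔ (p a ↔ p b)
  constructor
  · rintro (⟨ha, hb, -⟩ | ⟨ha, hb, -⟩)
    · exact iff_of_true ha hb
    · exact iff_of_false ha hb
  · intro h
    by_cases ha : p a
    · exact Or.inl ⟨ha, h.1 ha, trivial⟩
    · exact Or.inr ⟨ha, mt h.2 ha, trivial⟩

theorem glue_bot {p : α → Prop} (hp : NonCrossingPred p) : glue hp ⊥ ⊥ = ⊥ := by
  refine bot_unique ?_
  rintro a b (⟨ha, hb, h⟩ | ⟨ha, hb, h⟩) <;> exact congrArg Subtype.val h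

theorem isLowerSet_range_glueEmbedding {p : α → Prop} (hp : NonCrossingPred p) :
    IsLowerSet (Set.range (glueEmbedding hp)) := by
  rintro _ t ht ⟨⟨r, s⟩, rfl⟩
  refine ⟨⟨⟨t.1.comap Subtype.val, fun _ _ _ _ => t.2 _ _ _ _⟩,
    ⟨t.1.comap Subtype.val, fun _ _ _ _ => t.2 _ _ _ _⟩⟩, ?_⟩
  refine Subtype.ext (Setoid.ext fun a b => ?_)
  constructor
  · rintro (⟨_, _, h⟩ | ⟨_, _, h⟩) <;> exact h
  · intro h
    rcases ht h with ⟨ha, hb, -⟩ | ⟨ha, hb, -⟩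
    · exact Or.inl ⟨ha, hb, h⟩
    · exact Or.inr ⟨ha, hb, h⟩

theorem mu_bot_twoBlock [Finite α] {p : α → Prop} (hp : NonCrossingPred p) :
    IncidenceAlgebra.mu ℤ ⊥ (twoBlock hp) =
      IncidenceAlgebra.mu ℤ (⊥ : NCSetoid {a // p a}) ⊤ *
        IncidenceAlgebra.mu ℤ (⊥ : NCSetoid {a // ¬ p a}) ⊤ := by
  rw [← glue_top hp, ← glue_bot hp]
  refine (mu_orderEmbedding (glueEmbedding hp) (isLowerSet_range_glueEmbedding hp)
    (⊥, ⊥) (⊤, ⊤)).trans ?_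
  have := congrArg (fun f => f (⊥, ⊥) (⊤, ⊤))
    (IncidenceAlgebra.mu_prod_mu (α := NCSetoid {a // p a}) (β := NCSetoid {a // ¬ p a}) ℤ)
  simp only [IncidenceAlgebra.prod_apply] at this
  convert this.symm

/-- The least non-crossing relation coarser than `x` that relates `i` and `j`. -/
def joinPair (i j : α) (x : NCSetoid α) : NCSetoid α :=
  ⟨sInf {z | (∃ w : NCSetoid α, w.1 = z) ∧ x.1 ≤ z ∧ z i j}, by
    intro a b c d hab hbc hcd hac hbd z hz
    obtain ⟨w, rfl⟩ := hz.1
    exact w.2 a b c d hab hbc hcd (hac _ hz) (hbd _ hz)⟩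

theorem joinPair_le_iff (i j : α) (x z : NCSetoid α) :
    joinPair i j x ≤ z ↔ x ≤ z ∧ z.1 i j := by
  constructor
  · intro h
    exact ⟨fun a b hab => h (show (joinPair i j x).1 a b from fun w hw => hw.2.1 hab),
      h (show (joinPair i j x).1 i j from fun w hw => hw.2.2)⟩
  · rintro ⟨h1, h2⟩ a b hab
    exact hab z.1 ⟨⟨z, rfl⟩, h1, h2⟩

/-- The interval `{1, …, k}` of `Fin n` does not cross its complement. -/
theorem nonCrossingPred_interval {n : ℕ} (k : ℕ) :
    NonCrossingPred (fun j : Fin n => 1 ≤ j.1 ∧ j.1 ≤ k) := by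
  intro a b c d hab hbc hcd
  simp only [Fin.lt_def] at *
  omega

/-- The relation obtained by merging the blocks of the first two points. -/
def mergeZeroOne {n : ℕ} (x : NCSetoid (Fin (n + 2))) : NCSetoid (Fin (n + 2)) where
  val :=
    { r := fun a b => x.1 a b ∨ (x.1 0 a ∨ x.1 1 a) ∧ (x.1 0 b ∨ x.1 1 b)
      iseqv :=
        { refl := fun a => Or.inl (x.1.refl a)
          symm := by
            rintro a b (h | h)
            · exact Or.inl (x.1.symm h)
            · exact Or.inr h.symm
          trans := by
            rintro a b c (h | ⟨h, h'⟩) (k | ⟨k, k'⟩)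
            · exact Or.inl (x.1.trans h k)
            · exact Or.inr ⟨k.imp (fun k => x.1.trans k (x.1.symm h))
                (fun k => x.1.trans k (x.1.symm h)), k'⟩
            · exact Or.inr ⟨h, h'.imp (fun h => x.1.trans h k) (fun h => x.1.trans h k)⟩
            · exact Or.inr ⟨h, k'⟩ } }
  property := by
    have hpos : ∀ a : Fin (n + 2), ¬(x.1 0 a ∨ x.1 1 a) → 0 < a ∧ 1 < a := by
      intro a ha
      have h0 : a ≠ 0 := by rintro rfl; exact ha (Or.inl (x.1.refl _))
      have h1 : a ≠ 1 := by rintro rfl; exact ha (Or.inr (x.1.refl _))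
      rw [Ne, Fin.ext_iff] at h0 h1
      rw [Fin.lt_def, Fin.lt_def]
      simp only [Fin.val_zero, Fin.val_one] at *
      omega
    rintro a b c d hab hbc hcd (hac | ⟨ha, hc⟩) (hbd | ⟨hb, hd⟩)
    · exact Or.inl (x.2 a b c d hab hbc hcd hac hbd)
    · refine Or.inr ⟨by_contra fun ha => ?_, hb⟩
      obtain ⟨h0, h1⟩ := hpos a ha
      exact ha (hb.imp (fun hb => x.2 0 a b c h0 hab hbc hb hac)
        (fun hb => x.2 1 a b c h1 hab hbc hb hac))
    · refine Or.inr ⟨ha, by_contra fun hb => ?_⟩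
      obtain ⟨h0, h1⟩ := hpos b hb
      exact hb (hc.imp (fun hc => x.2 0 b c d h0 hbc hcd hc hbd)
        (fun hc => x.2 1 b c d h1 hbc hcd hc hbd))
    · exact Or.inr ⟨ha, hb⟩

theorem joinPair_eq_top_iff {n : ℕ} (x : NCSetoid (Fin (n + 2))) :
    joinPair 0 1 x = ⊤ ↔
      x = ⊤ ∨ ∃ k ∈ range (n + 1), twoBlock (nonCrossingPred_interval (k + 1)) = x := by
  constructor
  · intro h
    have hz : mergeZeroOne x = ⊤ := by
      refine top_unique (h ▸ (joinPair_le_iff _ _ _ _).2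
        ⟨fun a b hab => Or.inl hab, Or.inr ⟨?_, ?_⟩⟩)
      · exact Or.inl (x.1.refl _)
      · exact Or.inr (x.1.refl _)
    have hall : ∀ j, x.1 0 j ∨ x.1 1 j := fun j =>
      (eq_top_iff_forall.1 hz 0 j).elim Or.inl And.right
    by_cases h01 : x.1 0 1
    · left
      have h0 : ∀ j, x.1 0 j := fun j => (hall j).elim id (x.1.trans h01)
      exact eq_top_iff_forall.2 fun a b => x.1.trans (x.1.symm (h0 a)) (h0 b)
    right
    have hne : (univ.filter fun j => x.1 1 j).Nonempty := ⟨1, by simp⟩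
    obtain ⟨k, hk, hmax⟩ := exists_max_image _ id hne
    simp only [mem_filter, mem_univ, true_and, id] at hk hmax
    have hk1 : 1 ≤ k.1 := hmax 1 (x.1.refl _)
    have hblock : ∀ j : Fin (n + 2), (1 ≤ j.1 ∧ j.1 ≤ k.1) ↔ x.1 1 j := by
      intro j
      constructor
      · rintro ⟨h1, h2⟩
        by_contra hj
        have hj0 := (hall j).resolve_right hj
        have h1' : 1 < j := lt_of_le_of_ne h1 (by rintro rfl; exact hj (x.1.refl _))
        have h2' : j < k := lt_of_le_of_ne h2 (by rintro rfl; exact hj hk)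
        exact h01 (x.2 0 1 j k Fin.zero_lt_one h1' h2' hj0 hk)
      · intro hj
        refine ⟨Nat.one_le_iff_ne_zero.2 fun h => h01 ?_, hmax j hj⟩
        obtain rfl : j = 0 := Fin.ext h
        exact x.1.symm hj
    refine ⟨k.1 - 1, mem_range.2 (by omega), Subtype.ext (Setoid.ext fun a b => ?_)⟩
    change ((1 ≤ a.1 ∧ a.1 ≤ k.1 - 1 + 1) ↔ (1 ≤ b.1 ∧ b.1 ≤ k.1 - 1 + 1)) ↔ _
    rw [Nat.sub_add_cancel hk1, hblock, hblock]
    constructor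
    · intro hab
      by_cases ha : x.1 1 a
      · exact x.1.trans (x.1.symm ha) (hab.1 ha)
      · exact x.1.trans (x.1.symm ((hall a).resolve_right ha))
          ((hall b).resolve_right (mt hab.2 ha))
    · intro hab
      exact ⟨fun ha => x.1.trans ha hab, fun hb => x.1.trans hb (x.1.symm hab)⟩
  · intro h
    have hle : x ≤ joinPair 0 1 x := ((joinPair_le_iff _ _ _ _).1 le_rfl).1
    have h01 : (joinPair 0 1 x).1 0 1 := ((joinPair_le_iff _ _ _ _).1 le_rfl).2
    obtain rfl | ⟨k, -, rfl⟩ := h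
    · exact top_unique hle
    set z := joinPair 0 1 (twoBlock (nonCrossingPred_interval (n := n + 2) (k + 1)))
    have h0 : ∀ j, z.1 0 j := by
      intro j
      by_cases hj : 1 ≤ j.1 ∧ j.1 ≤ k + 1
      · exact z.1.trans h01 (hle (iff_of_true (by simp) hj))
      · exact hle (iff_of_false (by simp) hj)
    exact eq_top_iff_forall.2 fun a b => z.1.trans (z.1.symm (h0 a)) (h0 b)

theorem mu_bot_top_eq_fin [Fintype α] {n : ℕ} (h : Fintype.card α = n) :
    IncidenceAlgebra.mu ℤ (⊥ : NCSetoid α) ⊤ = IncidenceAlgebra.mu ℤ (⊥ : NCSetoid (Fin n)) ⊤ :=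
  (mu_bot_top_congr (Fintype.orderIsoFinOfCardEq α h)).symm

theorem card_interval {n k : ℕ} (hk : k < n + 1) :
    Fintype.card {j : Fin (n + 2) // 1 ≤ j.1 ∧ j.1 ≤ k + 1} = k + 1 := by
  rw [Fintype.card_subtype]
  have : (univ.filter fun j : Fin (n + 2) => 1 ≤ j.1 ∧ j.1 ≤ k + 1)
      = Icc 1 ⟨k + 1, by omega⟩ := by
    ext j
    simp [Fin.le_def]
  rw [this, Fin.card_Icc]
  simp

theorem mu_bot_interval {n k : ℕ} (hk : k < n + 1) :
    IncidenceAlgebra.mu ℤ ⊥ (twoBlock (nonCrossingPred_interval (n := n + 2) (k + 1))) =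
      IncidenceAlgebra.mu ℤ (⊥ : NCSetoid (Fin (k + 1))) ⊤ *
        IncidenceAlgebra.mu ℤ (⊥ : NCSetoid (Fin (n - k + 1))) ⊤ := by
  have hcompl : Fintype.card {j : Fin (n + 2) // ¬ (1 ≤ j.1 ∧ j.1 ≤ k + 1)} = n - k + 1 := by
    rw [Fintype.card_subtype_compl, card_interval hk, Fintype.card_fin]
    omega
  rw [mu_bot_twoBlock, mu_bot_top_eq_fin (card_interval hk), mu_bot_top_eq_fin hcompl]

theorem twoBlock_interval_injOn (n : ℕ) :
    Set.InjOn (fun k => twoBlock (nonCrossingPred_interval (n := n + 2) (k + 1)))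
      (range (n + 1)) := by
  have key : ∀ k l, k < l → l < n + 1 →
      twoBlock (nonCrossingPred_interval (n := n + 2) (k + 1)) ≠
        twoBlock (nonCrossingPred_interval (n := n + 2) (l + 1)) := by
    intro k l hkl hl h
    have h' : (twoBlock (nonCrossingPred_interval (n := n + 2) (k + 1))).1 1 ⟨l + 1, by omega⟩ := by
      rw [h]
      exact iff_of_true (by simp) (by simp)
    have := (h'.1 (by simp)).2
    simp only at this
    omega
  intro k hk l hl h
  simp only [coe_range, Set.mem_Iio] at hk hl
  rcases lt_trichotomy k l with hkl | hkl | hkl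
  · exact absurd h (key k l hkl hl)
  · exact hkl
  · exact absurd h.symm (key l k hkl hk)

theorem twoBlock_interval_ne_top (n k : ℕ) :
    twoBlock (nonCrossingPred_interval (n := n + 2) (k + 1)) ≠ ⊤ := by
  intro h
  have := (eq_top_iff_forall.1 h 0 1).2 (by simp)
  simp at this

theorem mu_bot_top_fin_add_two (n : ℕ) :
    IncidenceAlgebra.mu ℤ (⊥ : NCSetoid (Fin (n + 2))) ⊤ =
      -∑ k ∈ range (n + 1), IncidenceAlgebra.mu ℤ (⊥ : NCSetoid (Fin (k + 1))) ⊤ *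
        IncidenceAlgebra.mu ℤ (⊥ : NCSetoid (Fin (n - k + 1))) ⊤ := by
  have h := sum_mu_bot_fiber_eq_zero (fun z : NCSetoid (Fin (n + 2)) => z.1 0 1)
    (fun h => Fin.zero_ne_one (show (0 : Fin (n + 2)) = 1 from h))
    (joinPair 0 1) (joinPair_le_iff 0 1) ⊤
  have hset : (univ.filter fun x : NCSetoid (Fin (n + 2)) => joinPair 0 1 x = ⊤) =
      insert ⊤ ((range (n + 1)).image
        fun k => twoBlock (nonCrossingPred_interval (n := n + 2) (k + 1))) := by
    ext x
    simp only [mem_filter, mem_univ, true_and, mem_insert, mem_image]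
    exact joinPair_eq_top_iff x
  rw [hset, sum_insert, sum_image (twoBlock_interval_injOn n)] at h
  · rw [eq_neg_of_add_eq_zero_left h]
    exact congrArg _ (sum_congr rfl fun k hk => mu_bot_interval (mem_range.1 hk))
  · simp only [mem_image, not_exists, not_and]
    exact fun k _ => twoBlock_interval_ne_top n k

theorem mu_bot_top_fin (n : ℕ) :
    IncidenceAlgebra.mu ℤ (⊥ : NCSetoid (Fin (n + 1))) ⊤ = (-1) ^ n * (catalan n : ℤ) := by
  induction n using Nat.strong_induction_on with
  | _ n ih =>
    cases n with
    | zero =>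
      have h : (⊥ : NCSetoid (Fin 1)) = ⊤ := eq_top_iff_forall.2 fun a b => Subsingleton.elim a b
      rw [← h, IncidenceAlgebra.mu_self]
      simp
    | succ n =>
      rw [mu_bot_top_fin_add_two, catalan_succ, ← sum_range (fun i => catalan i * catalan (n - i)),
        Nat.cast_sum, pow_succ, mul_neg_one, neg_mul, mul_sum]
      refine congrArg _ (sum_congr rfl fun k hk => ?_)
      have hk' := mem_range.1 hk
      rw [ih k hk', ih (n - k) (by omega), Nat.cast_mul,
        show (-1 : ℤ) ^ n = (-1) ^ k * (-1) ^ (n - k) by rw [← pow_add]; congr 1; omega]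
      ring

end NCSetoid

/-- The equivalence relation "lying in the same block". -/
def Finpartition.toSetoid {α : Type*} [Fintype α] [DecidableEq α]
    (P : Finpartition (univ : Finset α)) : Setoid α where
  r a b := ∃ B ∈ P.parts, a ∈ B ∧ b ∈ B
  iseqv :=
    { refl := fun a => ⟨P.part a, P.part_mem.2 (mem_univ a), P.mem_part (mem_univ a),
        P.mem_part (mem_univ a)⟩
      symm := fun ⟨B, hB, ha, hb⟩ => ⟨B, hB, hb, ha⟩
      trans := fun ⟨B, hB, ha, hb⟩ ⟨_, hB', hb', hc⟩ =>
        ⟨B, hB, ha, P.eq_of_mem_parts hB hB' hb hb' ▸ hc⟩ }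

theorem Finpartition.toSetoid_le_iff {α : Type*} [Fintype α] [DecidableEq α]
    {P Q : Finpartition (univ : Finset α)} : P.toSetoid ≤ Q.toSetoid ↔ P ≤ Q := by
  constructor
  · intro h B hB
    obtain ⟨a, ha⟩ := P.nonempty_of_mem_parts hB
    refine ⟨Q.part a, Q.part_mem.2 (mem_univ a), fun b hb => ?_⟩
    exact Q.mem_part_iff_exists.2 (Q.toSetoid.symm (h ⟨B, hB, ha, hb⟩))
  · rintro h a b ⟨B, hB, ha, hb⟩
    obtain ⟨C, hC, hBC⟩ := h hB
    exact ⟨C, hC, hBC ha, hBC hb⟩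

theorem Finpartition.toSetoid_ofSetoid {α : Type*} [Fintype α] [DecidableEq α] (r : Setoid α) :
    (Finpartition.ofSetoid r).toSetoid = r :=
  Setoid.ext fun a b => by
    rw [← Finpartition.mem_part_ofSetoid_iff_rel (s := r), Finpartition.mem_part_iff_exists]
    exact (Finpartition.ofSetoid r).toSetoid.comm'

theorem isNoncrossing_iff_toSetoid {m : ℕ} (P : Finpartition (univ : Finset (Fin m))) :
    IsNoncrossing P ↔ ∀ a b c d, a < b → b < c → c < d →
      P.toSetoid a c → P.toSetoid b d → P.toSetoid a b := by
  constructor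
  · rintro h a b c d hab hbc hcd ⟨B, hB, ha, hc⟩ ⟨B', hB', hb, hd⟩
    by_contra hn
    refine h ⟨a, b, c, d, hab, hbc, hcd, B, hB, B', hB', ?_, ha, hc, hb, hd⟩
    rintro rfl
    exact hn ⟨B, hB, ha, hb⟩
  · rintro h ⟨a, b, c, d, hab, hbc, hcd, B, hB, B', hB', hne, ha, hc, hb, hd⟩
    obtain ⟨D, hD, ha', hb'⟩ := h a b c d hab hbc hcd ⟨B, hB, ha, hc⟩ ⟨B', hB', hb, hd⟩
    exact hne ((P.eq_of_mem_parts hB hD ha ha').trans (P.eq_of_mem_parts hD hB' hb' hb))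

/-- Non-crossing partitions embed into non-crossing equivalence relations. -/
def NC.toNCSetoid (m : ℕ) : NC m ↪o NCSetoid (Fin m) :=
  OrderEmbedding.ofMapLEIff (fun P => ⟨P.1.toSetoid, (isNoncrossing_iff_toSetoid P.1).1 P.2⟩)
    fun _ _ => Finpartition.toSetoid_le_iff

theorem NC.toNCSetoid_surjective (m : ℕ) : Function.Surjective (NC.toNCSetoid m) := by
  rintro ⟨r, hr⟩
  refine ⟨⟨Finpartition.ofSetoid r, (isNoncrossing_iff_toSetoid _).2 ?_⟩, Subtype.ext ?_⟩
  · rwa [Finpartition.toSetoid_ofSetoid]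
  · exact Finpartition.toSetoid_ofSetoid r

/-- Kreweras' formula: the Möbius function of the lattice of non-crossing partitions of
`Fin m` evaluated at the pair (bottom, top) is `(-1)^(m-1)` times the `(m-1)`-st Catalan
number.  Here `bot` is the partition of `Fin m` into `m` singletons and `top` is the
partition with a single block. -/
theorem mu_noncrossing_bot_top (m : ℕ) (hm : 1 ≤ m) (bot top : NC m)
    (hbot : bot.val = ⊥) (htop : top.val = ⊤) :
    IncidenceAlgebra.mu ℤ bot top = (-1) ^ (m - 1) * (catalan (m - 1) : ℤ) := by
  have hb : NC.toNCSetoid m bot = ⊥ := by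
    obtain ⟨P, hP⟩ := NC.toNCSetoid_surjective m ⊥
    refine bot_unique (hP ▸ (NC.toNCSetoid m).le_iff_le.2 ?_)
    exact hbot.trans_le bot_le
  have ht : NC.toNCSetoid m top = ⊤ := by
    obtain ⟨P, hP⟩ := NC.toNCSetoid_surjective m ⊤
    refine top_unique (hP ▸ (NC.toNCSetoid m).le_iff_le.2 ?_)
    exact (le_top : P.val ≤ ⊤).trans_eq htop.symm
  have hlower : IsLowerSet (Set.range (NC.toNCSetoid m)) := by
    rw [(NC.toNCSetoid_surjective m).range_eq]
    exact isLowerSet_univ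
  rw [← mu_orderEmbedding (NC.toNCSetoid m) hlower bot top, hb, ht]
  obtain ⟨n, rfl⟩ := Nat.exists_eq_add_of_le' hm
  exact NCSetoid.mu_bot_top_fin n
end

section
/- The poset NC(m) of non-crossing partitions of Fin m is graded by the rank function rk(p) = m − (number of blocks of p): for every p ∈ NC(m), every maximal chain in NC(m) from the bottom element ⊥ (the partition into singletons) to p has length rk(p). In particular, every maximal chain from ⊥ to the top element ⊤ (the one-block partition) has length m − 1. -/
open Finset

theorem IsNoncrossing.between {m : ℕ} {s : Finset (Fin m)} {P : Finpartition s}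
    (hP : IsNoncrossing P) {E X : Finset (Fin m)} (hE : E ∈ P.parts) (hX : X ∈ P.parts)
    (hne : E ≠ X) {e f x y : Fin m} (he : e ∈ E) (hf : f ∈ E) (hx : x ∈ X) (hy : y ∈ X)
    (h : e < x ∧ x < f) : e < y ∧ y < f := by
  have hye : y ≠ e := fun h ↦ hne (P.eq_of_mem_parts hE hX (h ▸ he) hy)
  have hyf : y ≠ f := fun h ↦ hne (P.eq_of_mem_parts hE hX (h ▸ hf) hy)
  by_contra hcon
  rcases lt_or_gt_of_ne hye with h1 | h1
  · exact hP ⟨y, e, x, f, h1, h.1, h.2, X, hX, E, hE, hne.symm, hy, hx, he, hf⟩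
  · have h2 : f < y := lt_of_le_of_ne (not_lt.1 fun h2 ↦ hcon ⟨h1, h2⟩) hyf.symm
    exact hP ⟨e, x, f, y, h.1, h.2, h2, E, hE, X, hX, hne, he, hf, hx, hy⟩

/-- The partition obtained from `P` by merging the parts `C` and `D`. -/
def Finpartition.merge {α : Type*} [DecidableEq α] {s : Finset α} (P : Finpartition s)
    {C D : Finset α} (hC : C ∈ P.parts) (hD : D ∈ P.parts) : Finpartition s :=
  .ofExistsUnique (insert (C ∪ D) ((P.parts.erase C).erase D))
    (by
      intro p hp
      simp only [mem_insert, mem_erase] at hp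
      rcases hp with rfl | hp
      · exact union_subset (P.subset hC) (P.subset hD)
      · exact P.subset hp.2.2)
    (by
      intro a ha
      obtain ⟨t, ⟨ht, hat⟩, -⟩ := P.existsUnique_mem ha
      have huniq : ∀ u ∈ P.parts, a ∈ u → u = t := fun u hu hau ↦ P.eq_of_mem_parts hu ht hau hat
      by_cases h : t = C ∨ t = D
      · refine ⟨C ∪ D, ?_, ?_⟩
        · grind
        · grind
      · refine ⟨t, ?_, ?_⟩
        · grind
        · grind)
    (by
      simp [eq_comm (a := ∅), union_eq_empty, P.ne_empty hC])

theorem Finpartition.mem_merge {α : Type*} [DecidableEq α] {s : Finset α} {P : Finpartition s}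
    {C D X : Finset α} {hC : C ∈ P.parts} {hD : D ∈ P.parts} :
    X ∈ (P.merge hC hD).parts ↔ X = C ∪ D ∨ X ≠ D ∧ X ≠ C ∧ X ∈ P.parts := by
  simp [Finpartition.merge]

theorem Finpartition.union_notMem_parts {α : Type*} [DecidableEq α] {s : Finset α}
    {P : Finpartition s} {C D : Finset α} (hC : C ∈ P.parts) (hD : D ∈ P.parts) (hne : C ≠ D) :
    C ∪ D ∉ P.parts := by
  intro h
  obtain ⟨c, hc⟩ := P.nonempty_of_mem_parts hC
  obtain ⟨d, hd⟩ := P.nonempty_of_mem_parts hD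
  exact hne ((P.eq_of_mem_parts hC h hc (mem_union_left _ hc)).trans
    (P.eq_of_mem_parts hD h hd (mem_union_right _ hd)).symm)

theorem Finpartition.card_merge {α : Type*} [DecidableEq α] {s : Finset α} {P : Finpartition s}
    {C D : Finset α} (hC : C ∈ P.parts) (hD : D ∈ P.parts) (hne : C ≠ D) :
    #(P.merge hC hD).parts + 1 = #P.parts := by
  have hU := union_notMem_parts hC hD hne
  have hD' : D ∈ P.parts.erase C := mem_erase.2 ⟨hne.symm, hD⟩
  simp only [Finpartition.merge, ofExistsUnique_parts]
  rw [card_insert_of_notMem (fun h ↦ hU (mem_of_mem_erase (mem_of_mem_erase h))),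
    card_erase_add_one hD', card_erase_add_one hC]

theorem Finpartition.lt_merge {α : Type*} [DecidableEq α] {s : Finset α} {P : Finpartition s}
    {C D : Finset α} (hC : C ∈ P.parts) (hD : D ∈ P.parts) (hne : C ≠ D) :
    P < P.merge hC hD := by
  refine lt_of_le_of_ne (fun X hX ↦ ?_) fun h ↦ ?_
  · by_cases h : X = C ∨ X = D
    · refine ⟨C ∪ D, mem_merge.2 (.inl rfl), ?_⟩
      rcases h with rfl | rfl
      exacts [subset_union_left, subset_union_right]
    · exact ⟨X, mem_merge.2 (by tauto), le_rfl⟩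
  · exact union_notMem_parts hC hD hne (h ▸ mem_merge.2 (.inl rfl))

theorem Finpartition.merge_le {α : Type*} [DecidableEq α] {s : Finset α} {P Q : Finpartition s}
    {B C D : Finset α} (hC : C ∈ P.parts) (hD : D ∈ P.parts) (h : P ≤ Q) (hB : B ∈ Q.parts)
    (hCB : C ⊆ B) (hDB : D ⊆ B) : P.merge hC hD ≤ Q := by
  intro X hX
  rcases mem_merge.1 hX with rfl | hX
  · exact ⟨B, hB, union_subset hCB hDB⟩
  · exact h hX.2.2

/-- Merging the blocks of two closest non-equivalent elements of a block of a coarser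
non-crossing partition preserves the non-crossing property. -/
theorem IsNoncrossing.merge {m : ℕ} {s : Finset (Fin m)} {P Q : Finpartition s}
    (hP : IsNoncrossing P) (hQ : IsNoncrossing Q) (hPQ : P ≤ Q) {B C D : Finset (Fin m)}
    (hB : B ∈ Q.parts) (hC : C ∈ P.parts) (hD : D ∈ P.parts) (hCB : C ⊆ B) (hDB : D ⊆ B)
    {x y : Fin m} (hx : x ∈ C) (hy : y ∈ D) (hxy : x < y)
    (hmin : ∀ X ∈ P.parts, ∀ Y ∈ P.parts, X ≠ Y → X ⊆ B → Y ⊆ B → ∀ u ∈ X, ∀ v ∈ Y, u < v →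
      (y : ℕ) - x ≤ v - u) :
    IsNoncrossing (P.merge hC hD) := by
  have key : ∀ E ∈ P.parts, E ≠ C → E ≠ D → ∀ e ∈ E, ∀ f ∈ E, ∀ u ∈ C ∪ D, ∀ v ∈ C ∪ D,
      e < u ∧ u < f → e < v ∧ v < f := by
    intro E hE hEC hED e he f hf u hu v hv huef
    obtain ⟨F, hF, hEF⟩ := hPQ hE
    by_cases hFB : F = B
    · subst hFB
      have hout : ∀ g ∈ E, g < x ∨ y < g := by
        intro g hg
        have hgx : g ≠ x := fun h ↦ hEC (P.eq_of_mem_parts hE hC hg (h ▸ hx))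
        have hgy : g ≠ y := fun h ↦ hED (P.eq_of_mem_parts hE hD hg (h ▸ hy))
        by_contra hcon
        have := hmin C hC E hE hEC.symm hCB hEF x hx g hg (by grind)
        grind
      have hiff : (e < x ∧ x < f) ↔ (e < y ∧ y < f) := by
        have h1 := hout e he
        have h2 := hout f hf
        grind
      have hxu : e < x ∧ x < f := by
        rcases mem_union.1 hu with hu | hu
        · exact hP.between hE hC hEC he hf hu hx huef
        · exact hiff.2 (hP.between hE hD hED he hf hu hy huef)
      rcases mem_union.1 hv with hv | hv
      · exact hP.between hE hC hEC he hf hx hv hxu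
      · exact hP.between hE hD hED he hf hy hv (hiff.1 hxu)
    · exact hQ.between hF hB hFB (hEF he) (hEF hf) (union_subset hCB hDB hu)
        (union_subset hCB hDB hv) huef
  rintro ⟨a, b, c, d, hab, hbc, hcd, X, hX, Y, hY, hXY, haX, hcX, hbY, hdY⟩
  rcases Finpartition.mem_merge.1 hX with rfl | ⟨hXD, hXC, hX⟩ <;>
    rcases Finpartition.mem_merge.1 hY with rfl | ⟨hYD, hYC, hY⟩
  · exact hXY rfl
  · exact (key Y hY hYC hYD b hbY d hdY c hcX a haX ⟨hbc, hcd⟩).1.not_gt hab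
  · exact (key X hX hXC hXD a haX c hcX b hbY d hdY ⟨hab, hbc⟩).2.not_gt hcd
  · exact hP ⟨a, b, c, d, hab, hbc, hcd, X, hX, Y, hY, hXY, haX, hcX, hbY, hdY⟩

theorem IsNoncrossing.exists_merge {m : ℕ} {s : Finset (Fin m)} {P Q : Finpartition s}
    (hP : IsNoncrossing P) (hQ : IsNoncrossing Q) (hPQ : P < Q) :
    ∃ R : Finpartition s, IsNoncrossing R ∧ P < R ∧ R ≤ Q ∧ #R.parts + 1 = #P.parts := by
  let S : Fin m × Fin m → Prop := fun z ↦ z.1 < z.2 ∧ ∃ B ∈ Q.parts, ∃ C ∈ P.parts, ∃ D ∈ P.parts,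
    C ≠ D ∧ C ⊆ B ∧ D ⊆ B ∧ z.1 ∈ C ∧ z.2 ∈ D
  have hS : ∃ z, S z := by
    by_contra hcon
    refine hPQ.not_ge fun B hB ↦ ?_
    obtain ⟨b, hb⟩ := Q.nonempty_of_mem_parts hB
    obtain ⟨C, hC, hbC⟩ := P.exists_mem (Q.subset hB hb)
    refine ⟨C, hC, fun d hd ↦ ?_⟩
    obtain ⟨D, hD, hdD⟩ := P.exists_mem (Q.subset hB hd)
    have hsub : ∀ X ∈ P.parts, ∀ t ∈ X, t ∈ B → X ⊆ B := by
      intro X hX t ht htB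
      obtain ⟨B', hB', hXB'⟩ := hPQ.le hX
      exact Q.eq_of_mem_parts hB' hB (hXB' ht) htB ▸ hXB'
    have hCB := hsub C hC b hbC hb
    have hDB := hsub D hD d hdD hd
    by_contra hdC
    have hne : C ≠ D := fun h ↦ hdC (h ▸ hdD)
    rcases lt_trichotomy b d with h | rfl | h
    · exact hcon ⟨(b, d), h, B, hB, C, hC, D, hD, hne, hCB, hDB, hbC, hdD⟩
    · exact hdC hbC
    · exact hcon ⟨(d, b), h, B, hB, D, hD, C, hC, hne.symm, hDB, hCB, hdD, hbC⟩
  classical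
  obtain ⟨z, hz, hzmin⟩ := exists_min_image (univ.filter S) (fun z ↦ (z.2 : ℕ) - z.1)
    (by simpa [Finset.Nonempty] using hS)
  obtain ⟨hlt, B, hB, C, hC, D, hD, hne, hCB, hDB, hzC, hzD⟩ := (mem_filter.1 hz).2
  refine ⟨P.merge hC hD, hP.merge hQ hPQ.le hB hC hD hCB hDB hzC hzD hlt ?_,
    Finpartition.lt_merge hC hD hne, Finpartition.merge_le hC hD hPQ.le hB hCB hDB,
    Finpartition.card_merge hC hD hne⟩
  intro X hX Y hY hXY hXB hYB u hu v hv huv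
  exact hzmin (u, v) (mem_filter.2 ⟨mem_univ _, huv, B, hB, X, hX, Y, hY, hXY, hXB, hYB, hu, hv⟩)

theorem NC.card_parts_of_covBy {m : ℕ} {p q : NC m} (h : p ⋖ q) :
    #q.val.parts + 1 = #p.val.parts := by
  obtain ⟨R, hR, hpR, hRq, hcard⟩ := p.2.exists_merge q.2 h.lt
  obtain rfl : (⟨R, hR⟩ : NC m) = q :=
    (lt_or_eq_of_le (show (⟨R, hR⟩ : NC m) ≤ q from hRq)).resolve_left (h.2 hpR)
  exact hcard

/-- The poset `NC m` is graded by `rk p = m - (number of blocks of p)`: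
every maximal chain `⊥ = f 0 ⋖ f 1 ⋖ ⋯ ⋖ f n = p` from the bottom element (the partition
into singletons) to `p` has length `n = m - #(blocks of p)`.  (Maximality of the chain is
expressed by saying that each step is a covering relation in `NC m`, i.e. no further
element of `NC m` can be inserted.)  In particular, taking `p` to be the one-block
partition `⊤`, every maximal chain from `⊥` to `⊤` has length `m - 1`. -/
theorem noncrossing_graded (m : ℕ) (p : NC m) (n : ℕ) (f : Fin (n + 1) → NC m)
    (hcov : ∀ i : Fin n, f i.castSucc ⋖ f i.succ)
    (h0 : (f 0).val = ⊥) (hlast : f (Fin.last n) = p) :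
    n = m - p.val.parts.card := by
  have key : ∀ i : Fin (n + 1), #(f i).val.parts + i = m := by
    intro i
    induction i using Fin.induction with
    | zero => simp [h0]
    | succ i ih =>
      have := NC.card_parts_of_covBy (hcov i)
      simp only [Fin.val_castSucc, Fin.val_succ] at ih ⊢
      omega
  have := key (Fin.last n)
  rw [hlast, Fin.val_last] at this
  omega
end

section
/- Let p be a non-crossing partition of Fin m with blocks B₁, …, B_k. Then the order ideal {q ∈ NC(m) : q ⪯ p} is order-isomorphic to the cartesian product NC(B₁) × ⋯ × NC(B_k) of the posets of non-crossing partitions of the blocks, via the map sending q to the tuple of restrictions of q to each block Bᵢ. -/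
open Finset

/-- The poset of non-crossing partitions of a finset `B` of `Fin m` (with its induced
linear order), ordered by refinement. -/
abbrev NCOn {m : ℕ} (B : Finset (Fin m)) := {P : Finpartition B // IsNoncrossing P}

namespace Finpartition

variable {α : Type*} [DecidableEq α] {s : Finset α}

/-- The partition that a refinement `Q` of `P` induces on a block of `P`. -/
def restrictPart {P Q : Finpartition s} (h : Q ≤ P) {B : Finset α} (hB : B ∈ P.parts) :
    Finpartition B :=
  Q.ofSubset (parts := Q.parts.filter (· ⊆ B)) (filter_subset _ _) <| by
    refine le_antisymm (Finset.sup_le fun C hC => (mem_filter.1 hC).2) fun x hx => ?_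
    obtain ⟨C, hC, hxC⟩ := Q.exists_mem (P.le hB hx)
    obtain ⟨D, hD, hCD⟩ := h hC
    obtain rfl := P.eq_of_mem_parts hD hB (hCD hxC) hx
    exact mem_sup.2 ⟨C, mem_filter.2 ⟨hC, hCD⟩, hxC⟩

theorem mem_restrictPart {P Q : Finpartition s} (h : Q ≤ P) {B C : Finset α}
    (hB : B ∈ P.parts) : C ∈ (restrictPart h hB).parts ↔ C ∈ Q.parts ∧ C ⊆ B :=
  mem_filter

theorem bind_le (P : Finpartition s) (Q : ∀ B ∈ P.parts, Finpartition B) : P.bind Q ≤ P := by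
  intro C hC
  obtain ⟨B, hB, hCB⟩ := mem_bind.1 hC
  exact ⟨B, hB, (Q B hB).le hCB⟩

theorem bind_restrictPart {P Q : Finpartition s} (h : Q ≤ P) :
    P.bind (fun _ hB => restrictPart h hB) = Q := by
  ext C
  simp only [mem_bind, mem_restrictPart]
  constructor
  · rintro ⟨-, -, hC, -⟩
    exact hC
  · intro hC
    obtain ⟨B, hB, hCB⟩ := h hC
    exact ⟨B, hB, hC, hCB⟩

theorem restrictPart_bind (P : Finpartition s) (Q : ∀ B ∈ P.parts, Finpartition B)
    {B : Finset α} (hB : B ∈ P.parts) : restrictPart (bind_le P Q) hB = Q B hB := by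
  ext C
  rw [mem_restrictPart, mem_bind]
  constructor
  · rintro ⟨⟨A, hA, hC⟩, hCB⟩
    obtain ⟨x, hx⟩ := (Q A hA).nonempty_of_mem_parts hC
    obtain rfl := P.eq_of_mem_parts hA hB ((Q A hA).le hC hx) (hCB hx)
    exact hC
  · exact fun hC => ⟨⟨B, hB, hC⟩, (Q B hB).le hC⟩

theorem restrictPart_le_restrictPart_iff {P Q R : Finpartition s} (hQ : Q ≤ P) (hR : R ≤ P) :
    (∀ (B) (hB : B ∈ P.parts), restrictPart hQ hB ≤ restrictPart hR hB) ↔ Q ≤ R := by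
  constructor
  · intro h C hC
    obtain ⟨B, hB, hCB⟩ := hQ hC
    obtain ⟨D, hD, hCD⟩ := h B hB ((mem_restrictPart hQ hB).2 ⟨hC, hCB⟩)
    exact ⟨D, ((mem_restrictPart hR hB).1 hD).1, hCD⟩
  · intro h B hB C hC
    obtain ⟨hC, hCB⟩ := (mem_restrictPart hQ hB).1 hC
    obtain ⟨D, hD, hCD⟩ := h hC
    obtain ⟨E, hE, hDE⟩ := hR hD
    obtain ⟨x, hx⟩ := Q.nonempty_of_mem_parts hC
    obtain rfl := P.eq_of_mem_parts hE hB (hDE (hCD hx)) (hCB hx)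
    exact ⟨D, (mem_restrictPart hR hB).2 ⟨hD, hDE⟩, hCD⟩

end Finpartition

namespace IsNoncrossing

variable {m : ℕ} {s : Finset (Fin m)} {P Q : Finpartition s}

theorem restrictPart (hQ : IsNoncrossing Q) (h : Q ≤ P) {B : Finset (Fin m)}
    (hB : B ∈ P.parts) : IsNoncrossing (Finpartition.restrictPart h hB) := by
  rintro ⟨a, b, c, d, hab, hbc, hcd, C, hC, C', hC', hne, hmem⟩
  exact hQ ⟨a, b, c, d, hab, hbc, hcd, C, ((Finpartition.mem_restrictPart h hB).1 hC).1,
    C', ((Finpartition.mem_restrictPart h hB).1 hC').1, hne, hmem⟩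

theorem bind (hP : IsNoncrossing P) {Q : ∀ B ∈ P.parts, Finpartition B}
    (hQ : ∀ (B) (hB : B ∈ P.parts), IsNoncrossing (Q B hB)) : IsNoncrossing (P.bind Q) := by
  rintro ⟨a, b, c, d, hab, hbc, hcd, C, hC, C', hC', hne, ha, hc, hb, hd⟩
  obtain ⟨A, hA, hCA⟩ := Finpartition.mem_bind.1 hC
  obtain ⟨A', hA', hCA'⟩ := Finpartition.mem_bind.1 hC'
  have hle := (Q A hA).le hCA
  have hle' := (Q A' hA').le hCA'
  by_cases hAA' : A = A'
  · subst hAA'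
    exact hQ A hA ⟨a, b, c, d, hab, hbc, hcd, C, hCA, C', hCA', hne, ha, hc, hb, hd⟩
  · exact hP ⟨a, b, c, d, hab, hbc, hcd, A, hA, A', hA', hAA',
      hle ha, hle hc, hle' hb, hle' hd⟩

end IsNoncrossing

/-- Let `p` be a non-crossing partition of `Fin m` with blocks `B₁, …, B_k`.  The order
ideal `{q ∈ NC m | q ⪯ p}` is order-isomorphic to the product `NC(B₁) × ⋯ × NC(B_k)`,
via the map sending `q` to the tuple of its restrictions to the blocks of `p`: the
restriction of `q` to a block `B` of `p` is the partition of `B` whose blocks are the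
blocks of `q` contained in `B`. -/
theorem orderIso_ideal_prod_blocks (m : ℕ) (p : NC m) :
    ∃ e : {q : NC m // q ≤ p} ≃o (∀ B : p.val.parts, NCOn (B : Finset (Fin m))),
      ∀ (q : {q : NC m // q ≤ p}) (B : p.val.parts),
        ((e q) B).val.parts
          = q.val.val.parts.filter (· ⊆ (B : Finset (Fin m))) := by
  refine ⟨{
    toFun := fun q B =>
      ⟨Finpartition.restrictPart q.2 B.2, q.1.2.restrictPart q.2 B.2⟩
    invFun := fun Q =>
      ⟨⟨p.1.bind fun B hB => (Q ⟨B, hB⟩).1, p.2.bind fun B hB => (Q ⟨B, hB⟩).2⟩,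
        Finpartition.bind_le _ _⟩
    left_inv := fun q => Subtype.ext <| Subtype.ext <| Finpartition.bind_restrictPart q.2
    right_inv := fun Q => funext fun B => Subtype.ext <|
      Finpartition.restrictPart_bind p.1 (fun B hB => (Q ⟨B, hB⟩).1) B.2
    map_rel_iff' := fun {q r} =>
      Subtype.forall.trans (Finpartition.restrictPart_le_restrictPart_iff q.2 r.2) },
    fun _ _ => rfl⟩
end

section
/- For every natural number k, the number of non-crossing partitions of Fin (2k) all of whose blocks have exactly two elements (non-crossing pair partitions, also called non-crossing perfect matchings) equals the k-th Catalan number C_k = (1/(k+1)) * choose(2k, k). -/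
open Finset

/-- A non-crossing perfect matching of the interval `[a, b)`, encoded as an involution of `ℕ` that
moves exactly the points of this interval. -/
structure IsNoncrossingMatching (a b : ℕ) (f : ℕ → ℕ) : Prop where
  involutive : ∀ x, f (f x) = x
  apply_ne_iff : ∀ x, f x ≠ x ↔ a ≤ x ∧ x < b
  noncrossing : ∀ x y, x < y → y < f x → f y ≤ f x

namespace IsNoncrossingMatching

variable {a b c : ℕ} {f g h : ℕ → ℕ}

lemma mem_interval (hf : IsNoncrossingMatching a b f) {x : ℕ} (hx : a ≤ x ∧ x < b) :
    a ≤ f x ∧ f x < b := by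
  have h1 := hf.involutive x
  have h2 := (hf.apply_ne_iff x).2 hx
  exact (hf.apply_ne_iff (f x)).1 (by rw [h1]; exact h2.symm)

lemma apply_of_notMem (hf : IsNoncrossingMatching a b f) {x : ℕ} (hx : x < a ∨ b ≤ x) :
    f x = x := by
  by_contra h
  have := (hf.apply_ne_iff x).1 h
  omega

lemma lt_apply_left (hf : IsNoncrossingMatching a b f) (hab : a < b) : a < f a ∧ f a < b := by
  have h1 := hf.mem_interval ⟨le_rfl, hab⟩
  have h2 := (hf.apply_ne_iff a).2 ⟨le_rfl, hab⟩
  omega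

lemma inside (hf : IsNoncrossingMatching a b f) (hab : a < b) :
    IsNoncrossingMatching (a + 1) (f a) (fun x ↦ if a < x ∧ x < f a then f x else x) := by
  have h0 := hf.lt_apply_left hab
  have h1 := hf.involutive
  have h2 := hf.apply_ne_iff
  have h3 := hf.noncrossing
  have h4 : ∀ x, a < x → x < f a → a < f x ∧ f x < f a := by
    intro x hx hx'
    have := h3 a x hx hx'
    have := hf.mem_interval (x := x) (by omega)
    grind
  constructor <;> grind

lemma outside (hf : IsNoncrossingMatching a b f) (hab : a < b) :
    IsNoncrossingMatching (f a + 1) b (fun x ↦ if f a < x then f x else x) := by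
  have h0 := hf.lt_apply_left hab
  have h1 := hf.involutive
  have h2 := hf.apply_ne_iff
  have h3 := hf.noncrossing
  have h4 : ∀ x, f a < x → f a < f x := by
    intro x hx
    by_cases hb : x < b
    · have := hf.mem_interval (x := x) (by omega)
      have := h3 a (f x)
      grind
    · rwa [hf.apply_of_notMem (Or.inr (not_lt.1 hb))]
  constructor <;> grind

/-- The matching joining `a` to `c`, agreeing with `g` before `c` and with `h` after `c`. -/
def join (a c : ℕ) (g h : ℕ → ℕ) (x : ℕ) : ℕ :=
  if x = a then c else if x = c then a else if x < c then g x else h x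

lemma isNoncrossingMatching_join (hg : IsNoncrossingMatching (a + 1) c g)
    (hh : IsNoncrossingMatching (c + 1) b h) (hac : a < c) (hcb : c < b) :
    IsNoncrossingMatching a b (join a c g h) := by
  have g4 := fun x ↦ hg.mem_interval (x := x)
  have g5 := fun x ↦ hg.apply_of_notMem (x := x)
  have h4 := fun x ↦ hh.mem_interval (x := x)
  have h5 := fun x ↦ hh.apply_of_notMem (x := x)
  have ja : join a c g h a = c := by simp [join]
  have jc : join a c g h c = a := by simp [join, hac.ne']
  have jg (x : ℕ) (hxa : x ≠ a) (hx : x < c) : join a c g h x = g x := by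
    simp [join, hxa, hx, hx.ne]
  have jh (x : ℕ) (hx : c < x) : join a c g h x = h x := by
    simp [join, hx.ne', (hac.trans hx).ne', hx.not_gt]
  have position (x : ℕ) : x < a ∨ x = a ∨ (a < x ∧ x < c) ∨ x = c ∨ (c < x ∧ x < b) ∨ b ≤ x := by
    omega
  constructor
  · intro x
    have := hg.involutive x
    have := hh.involutive x
    rcases position x with hx | rfl | hx | rfl | hx | hx <;> grind
  · intro x
    have := hg.apply_ne_iff x
    have := hh.apply_ne_iff x
    rcases position x with hx | rfl | hx | rfl | hx | hx <;> grind
  · intro x y hxy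
    have := hg.noncrossing x y hxy
    have := hh.noncrossing x y hxy
    rcases position x with hx | rfl | hx | rfl | hx | hx <;>
      rcases position y with hy | rfl | hy | rfl | hy | hy <;> grind

lemma sigma_ext {s t : Σ c : Ioo a b, {g // IsNoncrossingMatching (a + 1) c g} ×
    {h // IsNoncrossingMatching (c + 1) b h}} (h₁ : s.1.1 = t.1.1) (h₂ : s.2.1.1 = t.2.1.1)
    (h₃ : s.2.2.1 = t.2.2.1) : s = t := by
  obtain ⟨⟨c, hc⟩, ⟨g, hg⟩, ⟨h, hh⟩⟩ := s
  obtain ⟨⟨c', hc'⟩, ⟨g', hg'⟩, ⟨h', hh'⟩⟩ := t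
  dsimp only at h₁ h₂ h₃
  subst h₁ h₂ h₃
  rfl

/-- Removing the pair of the left endpoint splits a non-crossing matching into the matchings
nested inside this pair and to its right. -/
def splitEquiv (hab : a < b) :
    {f // IsNoncrossingMatching a b f} ≃
      Σ c : Ioo a b, {g // IsNoncrossingMatching (a + 1) c g} ×
        {h // IsNoncrossingMatching (c + 1) b h} where
  toFun f := ⟨⟨f.1 a, mem_Ioo.2 (f.2.lt_apply_left hab)⟩, ⟨_, f.2.inside hab⟩, ⟨_, f.2.outside hab⟩⟩
  invFun t := ⟨join a t.1 t.2.1.1 t.2.2.1,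
    isNoncrossingMatching_join t.2.1.2 t.2.2.2 (mem_Ioo.1 t.1.2).1 (mem_Ioo.1 t.1.2).2⟩
  left_inv := by
    rintro ⟨f, hf⟩
    ext x
    have := hf.involutive a
    have := hf.lt_apply_left hab
    have := fun x ↦ hf.apply_of_notMem (x := x)
    simp only [join]
    grind
  right_inv := by
    rintro ⟨⟨c, hc⟩, ⟨g, hg⟩, ⟨h, hh⟩⟩
    have hc' := mem_Ioo.1 hc
    have hj : join a c g h a = c := by simp [join]
    have h5 := fun x ↦ hh.apply_of_notMem (x := x)
    have g5 := fun x ↦ hg.apply_of_notMem (x := x)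
    refine sigma_ext hj ?_ ?_
    · funext x
      simp only [hj]
      unfold join
      grind
    · funext x
      simp only [hj]
      unfold join
      grind

lemma iff_eq_id_of_le (hab : b ≤ a) : IsNoncrossingMatching a b f ↔ f = id := by
  constructor
  · intro hf
    funext x
    exact hf.apply_of_notMem (by omega)
  · rintro rfl
    constructor <;> grind

instance finite (a b : ℕ) : Finite {f // IsNoncrossingMatching a b f} := by
  induction hn : b - a using Nat.strong_induction_on generalizing a b with
  | _ n ih =>
    by_cases hab : a < b
    · have (c : Ioo a b) : Finite {g // IsNoncrossingMatching (a + 1) c g} :=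
        have := mem_Ioo.1 c.2
        ih _ (by omega) _ _ rfl
      have (c : Ioo a b) : Finite {g // IsNoncrossingMatching (c + 1) b g} :=
        have := mem_Ioo.1 c.2
        ih _ (by omega) _ _ rfl
      exact Finite.of_equiv _ (splitEquiv hab).symm
    · simp only [iff_eq_id_of_le (not_lt.1 hab)]
      infer_instance

lemma card_of_lt (hab : a < b) :
    Nat.card {f // IsNoncrossingMatching a b f} =
      ∑ c ∈ Ioo a b, Nat.card {f // IsNoncrossingMatching (a + 1) c f} *
        Nat.card {f // IsNoncrossingMatching (c + 1) b f} := by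
  rw [Nat.card_congr (splitEquiv hab), Nat.card_sigma]
  simp only [Nat.card_prod]
  exact sum_coe_sort (Ioo a b) (fun c ↦ Nat.card {f // IsNoncrossingMatching (a + 1) c f} *
        Nat.card {f // IsNoncrossingMatching (c + 1) b f})

lemma card_odd (a k : ℕ) : Nat.card {f // IsNoncrossingMatching a (a + (2 * k + 1)) f} = 0 := by
  induction k using Nat.strong_induction_on generalizing a with
  | _ k ih =>
    rw [card_of_lt (by omega)]
    refine sum_eq_zero fun c hc ↦ ?_
    rw [mem_Ioo] at hc
    rcases Nat.even_or_odd' (c - a) with ⟨i, hi | hi⟩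
    · have := ih (i - 1) (by omega) (a + 1)
      rw [show a + 1 + (2 * (i - 1) + 1) = c by omega] at this
      rw [this, zero_mul]
    · have := ih (k - i - 1) (by omega) (c + 1)
      rw [show c + 1 + (2 * (k - i - 1) + 1) = a + (2 * k + 1) by omega] at this
      rw [this, mul_zero]

lemma card_even (a k : ℕ) :
    Nat.card {f // IsNoncrossingMatching a (a + 2 * k) f} = catalan k := by
  induction k using Nat.strong_induction_on generalizing a with
  | _ k ih =>
    cases k with
    | zero => simp [iff_eq_id_of_le]
    | succ k =>
      rw [card_of_lt (by omega), catalan_succ,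
        Fin.sum_univ_eq_sum_range (fun i ↦ catalan i * catalan (k - i))]
      symm
      refine sum_of_injOn (fun i ↦ a + (2 * i + 1)) (fun i _ j _ h ↦ by grind)
        (fun i hi ↦ by simp at hi ⊢; omega) (fun c hc hc' ↦ ?_) (fun i hi ↦ ?_)
      · rw [mem_Ioo] at hc
        obtain ⟨i, hi | hi⟩ := Nat.even_or_odd' (c - a)
        · have := card_odd (a + 1) (i - 1)
          rw [show a + 1 + (2 * (i - 1) + 1) = c by omega] at this
          rw [this, zero_mul]
        · exact absurd ⟨i, by simp; omega, by simp; omega⟩ hc'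
      · rw [Finset.mem_range] at hi
        rw [← ih i (by omega) (a + 1), ← ih (k - i) (by omega) (a + (2 * i + 1) + 1)]
        rw [show a + 1 + 2 * i = a + (2 * i + 1) by omega,
          show a + (2 * i + 1) + 1 + 2 * (k - i) = a + 2 * (k + 1) by omega]

end IsNoncrossingMatching

/-- The involution `f` exchanges the two elements of each block of `P`. -/
def Matches {n : ℕ} (P : Finpartition (univ : Finset (Fin n))) (f : ℕ → ℕ) : Prop :=
  ∀ x y : Fin n, y ∈ P.part x ↔ y = x ∨ (y : ℕ) = f x

section
variable {n : ℕ} {P P' : Finpartition (univ : Finset (Fin n))} {f f' : ℕ → ℕ}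

lemma Matches.partition_unique (h : Matches P f) (h' : Matches P' f) : P = P' := by
  have key (x : Fin n) : P.part x = P'.part x := by ext y; rw [h, h']
  ext B
  constructor
  · intro hB
    obtain ⟨x, hx⟩ := P.nonempty_of_mem_parts hB
    rw [← P.part_eq_of_mem hB hx, key]
    exact P'.part_mem.2 (mem_univ x)
  · intro hB
    obtain ⟨x, hx⟩ := P'.nonempty_of_mem_parts hB
    rw [← P'.part_eq_of_mem hB hx, ← key]
    exact P.part_mem.2 (mem_univ x)

lemma Matches.matching_unique (h : Matches P f) (h' : Matches P f')
    (hf : IsNoncrossingMatching 0 n f) (hf' : IsNoncrossingMatching 0 n f') : f = f' := by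
  funext x
  by_cases hx : x < n
  · have h1 := (hf.mem_interval ⟨Nat.zero_le x, hx⟩).2
    have h2 := (hf.apply_ne_iff x).2 ⟨Nat.zero_le x, hx⟩
    have h3 := (h' ⟨x, hx⟩ ⟨f x, h1⟩).1 ((h _ _).2 (Or.inr rfl))
    simpa [h2] using h3
  · rw [hf.apply_of_notMem (by omega), hf'.apply_of_notMem (by omega)]

lemma IsNoncrossingMatching.exists_matches (hf : IsNoncrossingMatching 0 n f) :
    ∃ P : Finpartition (univ : Finset (Fin n)),
      (IsNoncrossing P ∧ ∀ B ∈ P.parts, B.card = 2) ∧ Matches P f := by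
  classical
  let s : Setoid (Fin n) :=
    { r x y := y = x ∨ (y : ℕ) = f x
      iseqv := by
        have := hf.involutive
        constructor <;> grind }
  have hm : Matches (Finpartition.ofSetoid s) f := fun x y ↦
    Finpartition.mem_part_ofSetoid_iff_rel
  refine ⟨_, ⟨?_, fun B hB ↦ ?_⟩, hm⟩
  · rintro ⟨a, b, c, d, hab, hbc, hcd, B, hB, B', hB', hne, ha, hc, hb, hd⟩
    rw [← Finpartition.part_eq_of_mem _ hB ha, hm] at hc
    rw [← Finpartition.part_eq_of_mem _ hB' hb, hm] at hd
    have := hf.noncrossing a b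
    grind
  · obtain ⟨x, hx⟩ := Finpartition.nonempty_of_mem_parts _ hB
    have h1 := (hf.mem_interval ⟨Nat.zero_le x, x.2⟩).2
    have h2 := (hf.apply_ne_iff x).2 ⟨Nat.zero_le x, x.2⟩
    refine card_eq_two.2 ⟨x, ⟨f x, h1⟩, by grind, ?_⟩
    ext y
    rw [← Finpartition.part_eq_of_mem _ hB hx, hm]
    simp [Fin.ext_iff]

lemma IsNoncrossing.exists_matches (hP : IsNoncrossing P) (hP₂ : ∀ B ∈ P.parts, B.card = 2) :
    ∃ f, IsNoncrossingMatching 0 n f ∧ Matches P f := by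
  have key (x : Fin n) : ∃ y, y ≠ x ∧ P.part x = {x, y} := by
    obtain ⟨u, v, huv, h⟩ := card_eq_two.1 (hP₂ _ (P.part_mem.2 (mem_univ x)))
    have hx := P.mem_part (mem_univ x)
    rw [h, mem_insert, mem_singleton] at hx
    rcases hx with rfl | rfl
    · exact ⟨v, huv.symm, h⟩
    · exact ⟨u, huv, by rw [h, pair_comm]⟩
  choose σ hσ hσ' using key
  have mem (x : Fin n) : σ x ∈ P.part x := by simp [hσ']
  have part_σ (x : Fin n) : P.part (σ x) = P.part x :=
    P.part_eq_of_mem (P.part_mem.2 (mem_univ x)) (mem x)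
  have inv (x : Fin n) : σ (σ x) = x := by
    have h : x ∈ P.part (σ x) := part_σ x ▸ P.mem_part (mem_univ x)
    rw [hσ', mem_insert, mem_singleton] at h
    exact (h.resolve_left (hσ x).symm).symm
  refine ⟨fun x ↦ if h : x < n then σ ⟨x, h⟩ else x, ⟨?_, ?_, ?_⟩, ?_⟩
  · intro x
    by_cases hx : x < n <;> simp [hx, inv]
  · intro x
    by_cases hx : x < n
    · simpa [hx, Fin.ext_iff] using hσ ⟨x, hx⟩
    · simp [hx]
  · intro x y hxy hy
    by_cases hx : x < n
    · simp only [hx, dite_true] at hy ⊢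
      have hyn : y < n := by omega
      simp only [hyn, dite_true]
      by_contra! hlt
      refine hP ⟨⟨x, hx⟩, ⟨y, hyn⟩, σ ⟨x, hx⟩, σ ⟨y, hyn⟩, hxy, hy, hlt,
        P.part ⟨x, hx⟩, P.part_mem.2 (mem_univ _), P.part ⟨y, hyn⟩, P.part_mem.2 (mem_univ _),
        fun h ↦ ?_, P.mem_part (mem_univ _), mem _, P.mem_part (mem_univ _), mem _⟩
      have : (⟨y, hyn⟩ : Fin n) ∈ P.part ⟨x, hx⟩ := h ▸ P.mem_part (mem_univ _)
      rw [hσ', mem_insert, mem_singleton] at this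
      simp only [Fin.ext_iff] at this
      omega
    · simp only [hx, dite_false] at hy
      omega
  · intro x y
    simp [hσ', Fin.ext_iff]

end

/-- The number of non-crossing pair partitions (non-crossing perfect matchings) of
`Fin (2k)`, i.e. non-crossing partitions all of whose blocks have exactly two elements,
is the `k`-th Catalan number. -/
theorem card_noncrossing_pair_partitions_eq_catalan (k : ℕ) :
    Nat.card {P : Finpartition (univ : Finset (Fin (2 * k))) //
        IsNoncrossing P ∧ ∀ B ∈ P.parts, B.card = 2} = catalan k := by
  choose F hF using fun P : {P : Finpartition (univ : Finset (Fin (2 * k))) //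
    IsNoncrossing P ∧ ∀ B ∈ P.parts, B.card = 2} ↦ P.2.1.exists_matches P.2.2
  have hbij : Function.Bijective
      (fun P ↦ (⟨F P, (hF P).1⟩ : {f // IsNoncrossingMatching 0 (2 * k) f})) := by
    refine ⟨fun P P' h ↦ ?_, fun f ↦ ?_⟩
    · rw [Subtype.mk.injEq] at h
      exact Subtype.ext ((hF P).2.partition_unique (h ▸ (hF P').2))
    · obtain ⟨P, hP, hm⟩ := f.2.exists_matches
      exact ⟨⟨P, hP⟩, Subtype.ext ((hF ⟨P, hP⟩).2.matching_unique hm (hF _).1 f.2)⟩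
  rw [Nat.card_eq_of_bijective _ hbij]
  simpa using IsNoncrossingMatching.card_even 0 k
end

section
/- The moments of the semicircle (Wigner) distribution are the Catalan numbers: for every natural number k, (1/(2π)) ∫_{−2}^{2} x^{2k} √(4 − x²) dx = C_k, and (1/(2π)) ∫_{−2}^{2} x^{2k+1} √(4 − x²) dx = 0, where C_k = (1/(k+1)) * choose(2k, k) is the k-th Catalan number. -/
open MeasureTheory intervalIntegral

/-- The Wallis formula for the even powers of the cosine over `[0, π]`. -/
theorem four_pow_mul_integral_cos_pow_even (k : ℕ) :
    (4 : ℝ) ^ k * ∫ θ in (0 : ℝ)..Real.pi, Real.cos θ ^ (2 * k) =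
      Real.pi * k.centralBinom := by
  induction k with
  | zero => simp
  | succ k ih =>
    have hrec : ((k : ℝ) + 1) * (k + 1).centralBinom = 2 * (2 * k + 1) * k.centralBinom :=
      mod_cast Nat.succ_mul_centralBinom_succ k
    have hk : (k : ℝ) + 1 ≠ 0 := by positivity
    rw [show 2 * (k + 1) = 2 * k + 2 by ring, integral_cos_pow]
    simp only [Real.sin_zero, Real.sin_pi, mul_zero, sub_zero, zero_div, zero_add]
    apply mul_left_cancel₀ hk
    rw [mul_left_comm _ Real.pi, hrec, mul_left_comm Real.pi, ← ih]
    push_cast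
    field_simp
    ring

/-- The substitution `x = 2 cos θ` in an integral against `√(4 - x²)`. -/
theorem integral_mul_sqrt_four_sub_sq {f : ℝ → ℝ} (hf : Continuous f) :
    ∫ x in (-2 : ℝ)..2, f x * Real.sqrt (4 - x ^ 2) =
      4 * ∫ θ in (0 : ℝ)..Real.pi, f (2 * Real.cos θ) * Real.sin θ ^ 2 := by
  have hsub := integral_comp_mul_deriv (a := 0) (b := Real.pi)
    (f := fun θ => 2 * Real.cos θ) (f' := fun θ => 2 * -Real.sin θ)
    (g := fun x => f x * Real.sqrt (4 - x ^ 2))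
    (fun θ _ => (Real.hasDerivAt_cos θ).const_mul 2) (by fun_prop) (by fun_prop)
  simp only [Real.cos_zero, Real.cos_pi, mul_one, mul_neg] at hsub
  rw [integral_symm, ← hsub, ← intervalIntegral.integral_neg,
    ← intervalIntegral.integral_const_mul]
  refine integral_congr fun θ hθ => ?_
  rw [Set.uIcc_of_le Real.pi_pos.le] at hθ
  have hsqrt : Real.sqrt (4 - (2 * Real.cos θ) ^ 2) = 2 * Real.sin θ := by
    rw [← Real.sqrt_sq (mul_nonneg zero_le_two (Real.sin_nonneg_of_mem_Icc hθ))]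
    congr 1
    linear_combination (-4) * Real.sin_sq_add_cos_sq θ
  simp only [Function.comp_apply, hsqrt]
  ring

/-- The moments of the semicircle (Wigner) distribution, with density
`w(x) = (1/(2π)) √(4 - x²)` on `[-2, 2]`, are the Catalan numbers: the `2k`-th moment is
the `k`-th Catalan number `C_k` and the odd moments vanish. -/
theorem semicircle_moments (k : ℕ) :
    (1 / (2 * Real.pi)) * (∫ x in (-2 : ℝ)..2, x ^ (2 * k) * Real.sqrt (4 - x ^ 2))
        = (catalan k : ℝ) ∧
    (1 / (2 * Real.pi)) * (∫ x in (-2 : ℝ)..2, x ^ (2 * k + 1) * Real.sqrt (4 - x ^ 2))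
        = 0 := by
  constructor
  · have hcat : ((k : ℝ) + 1) * catalan k = k.centralBinom :=
      mod_cast succ_mul_catalan_eq_centralBinom k
    have hsplit : ∫ θ in (0 : ℝ)..Real.pi, (2 * Real.cos θ) ^ (2 * k) * Real.sin θ ^ 2 =
        4 ^ k * (∫ θ in (0 : ℝ)..Real.pi, Real.cos θ ^ (2 * k)) -
          4 ^ k * ∫ θ in (0 : ℝ)..Real.pi, Real.cos θ ^ (2 * (k + 1)) := by
      rw [← mul_sub, ← intervalIntegral.integral_sub
          (Continuous.intervalIntegrable (by fun_prop) _ _)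
          (Continuous.intervalIntegrable (by fun_prop) _ _),
        ← intervalIntegral.integral_const_mul]
      refine integral_congr fun θ _ => ?_
      simp only [Real.sin_sq, mul_pow, pow_mul]
      ring
    have hrec : ((k : ℝ) + 1) * (k + 1).centralBinom = 2 * (2 * k + 1) * k.centralBinom :=
      mod_cast Nat.succ_mul_centralBinom_succ k
    have hk : (k : ℝ) + 1 ≠ 0 := by positivity
    have hsucc := four_pow_mul_integral_cos_pow_even (k + 1)
    rw [pow_succ] at hsucc
    rw [integral_mul_sqrt_four_sub_sq (continuous_pow _), hsplit,
      four_pow_mul_integral_cos_pow_even, one_div, inv_mul_eq_iff_eq_mul₀ (by positivity)]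
    apply mul_left_cancel₀ hk
    linear_combination (-(k + 1 : ℝ)) * hsucc - Real.pi * hrec - 2 * Real.pi * hcat
  · have hneg := integral_comp_neg (a := -2) (b := 2)
      fun x : ℝ => x ^ (2 * k + 1) * Real.sqrt (4 - x ^ 2)
    simp only [(odd_two_mul_add_one k).neg_pow, neg_sq, neg_mul, neg_neg,
      intervalIntegral.integral_neg] at hneg
    rw [self_eq_neg.mp hneg.symm, mul_zero]
end

section
/- The moments of the Marchenko–Pastur (free Poisson) distribution are the Catalan numbers: for every natural number k, (1/(2π)) ∫_{0}^{4} x^{k} √(4/x − 1) dx = C_k, where C_k = (1/(k+1)) * choose(2k, k) is the k-th Catalan number. In particular (k = 0) this shows the Marchenko–Pastur density integrates to 1. -/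
open MeasureTheory intervalIntegral

theorem integral_sin_pow_add_two_zero_pi_div_two (n : ℕ) :
    ∫ t in (0 : ℝ)..Real.pi / 2, Real.sin t ^ (n + 2) =
      (n + 1) / (n + 2) * ∫ t in (0 : ℝ)..Real.pi / 2, Real.sin t ^ n := by
  rw [integral_sin_pow]
  simp

theorem integral_sin_pow_even_zero_pi_div_two (k : ℕ) :
    ∫ t in (0 : ℝ)..Real.pi / 2, Real.sin t ^ (2 * k) =
      Real.pi / 2 * k.centralBinom / 4 ^ k := by
  induction k with
  | zero => simp
  | succ k ih =>
    have h : ((k : ℝ) + 1) * (k + 1).centralBinom = 2 * (2 * k + 1) * k.centralBinom := by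
      exact_mod_cast Nat.succ_mul_centralBinom_succ k
    rw [mul_add_one, integral_sin_pow_add_two_zero_pi_div_two, ih, pow_succ]
    push_cast
    field_simp
    linear_combination (-2 : ℝ) * h

theorem integral_pow_mul_sqrt_four_div_sub_one (k : ℕ) :
    ∫ x in (0 : ℝ)..4, x ^ k * Real.sqrt (4 / x - 1) =
      8 * 4 ^ k * ∫ t in (0 : ℝ)..Real.pi / 2,
        (Real.sin t ^ (2 * k) - Real.sin t ^ (2 * k + 2)) := by
  have hπ : (0 : ℝ) ≤ Real.pi / 2 := by positivity
  have pos : ∀ t ∈ Set.Ioo (0 : ℝ) (Real.pi / 2), 0 < Real.sin t ∧ 0 < Real.cos t :=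
    fun t ht => ⟨Real.sin_pos_of_pos_of_lt_pi ht.1 (by linarith [ht.2, Real.pi_pos]),
      Real.cos_pos_of_mem_Ioo ⟨by linarith [ht.1, Real.pi_pos], ht.2⟩⟩
  have key := integral_comp_mul_deriv_of_deriv_nonneg (a := 0) (b := Real.pi / 2)
    (f := fun t => 4 * Real.sin t ^ 2) (f' := fun t => 8 * Real.sin t * Real.cos t)
    (g := fun x => x ^ k * Real.sqrt (4 / x - 1)) (by fun_prop)
    (fun t _ => by
      have h := ((Real.hasDerivAt_sin t).pow 2).const_mul 4
      convert! h using 1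
      norm_num
      ring)
    (fun t ht => by
      rw [min_eq_left hπ, max_eq_right hπ] at ht
      obtain ⟨hs, hc⟩ := pos t ht
      positivity)
  norm_num at key
  rw [← key, ← intervalIntegral.integral_const_mul]
  refine integral_congr_Ioo_of_le hπ fun t ht => ?_
  obtain ⟨hs, hc⟩ := pos t ht
  have hsq : Real.sqrt (4 / (4 * Real.sin t ^ 2) - 1) = Real.cos t / Real.sin t := by
    rw [← Real.sqrt_sq (div_pos hc hs).le, div_pow, Real.cos_sq']
    congr 1
    field_simp
  simp only [hsq]
  field_simp
  rw [Real.cos_sq', mul_pow, ← pow_mul]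
  ring

/-- The moments of the Marchenko–Pastur (free Poisson) distribution, with density
`p(x) = (1/(2π)) √(4/x - 1)` on `(0, 4]`, are the Catalan numbers: for every `k`, the
`k`-th moment is the `k`-th Catalan number `C_k`.  In particular (`k = 0`) the
Marchenko–Pastur density integrates to `1`. -/
theorem marchenkoPastur_moments (k : ℕ) :
    (1 / (2 * Real.pi)) * (∫ x in (0 : ℝ)..4, x ^ k * Real.sqrt (4 / x - 1))
        = (catalan k : ℝ) := by
  have h : ((k : ℝ) + 1) * catalan k = k.centralBinom := by
    exact_mod_cast succ_mul_catalan_eq_centralBinom k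
  rw [integral_pow_mul_sqrt_four_div_sub_one, intervalIntegral.integral_sub,
    integral_sin_pow_add_two_zero_pi_div_two, integral_sin_pow_even_zero_pi_div_two, ← h]
  · push_cast
    field_simp
    ring
  · exact (by fun_prop : Continuous fun t => Real.sin t ^ (2 * k)).intervalIntegrable _ _
  · exact (by fun_prop : Continuous fun t => Real.sin t ^ (2 * k + 2)).intervalIntegrable _ _
end

section
/- Let (W, S) be a Coxeter system of finite rank and let c = s₁ ⋯ s_m be a product of m pairwise distinct simple reflections (a parabolic standard Coxeter element). Then ℓ_T(c) = m and the Hurwitz action of the braid group on m strands is transitive on Red_T(c): any two reduced reflection factorizations of c are connected by a finite sequence of Hurwitz moves and their inverses. -/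
/-- The reflection length `ℓ_T w` of `w` in a Coxeter system: the least `k` such that
`w` is a product of `k` reflections. -/
noncomputable def reflLen {B W : Type*} [Group W] {M : CoxeterMatrix B}
    (cs : CoxeterSystem M W) (w : W) : ℕ :=
  sInf {k | ∃ l : List W, l.length = k ∧ (∀ t ∈ l, cs.IsReflection t) ∧ l.prod = w}

/-- `Red_T w`: the set of reduced reflection factorizations of `w`, i.e. tuples of
reflections of length `ℓ_T w` with product `w`. -/
noncomputable def RedT {B W : Type*} [Group W] {M : CoxeterMatrix B}
    (cs : CoxeterSystem M W) (w : W) : Set (List W) :=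
  {l | l.length = reflLen cs w ∧ (∀ t ∈ l, cs.IsReflection t) ∧ l.prod = w}

/-- A Hurwitz move: replace two consecutive entries `(t, t')` of a tuple by
`(t t' t⁻¹, t)`. -/
def HurwitzMove {W : Type*} [Group W] (a b : List W) : Prop :=
  ∃ (l₁ l₂ : List W) (t t' : W),
    a = l₁ ++ t :: t' :: l₂ ∧ b = l₁ ++ (t * t' * t⁻¹) :: t :: l₂

/-- Two tuples are Hurwitz equivalent if they are connected by a finite sequence of
Hurwitz moves and their inverses. -/
def HurwitzEquiv {W : Type*} [Group W] : List W → List W → Prop :=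
  Relation.ReflTransGen fun a b => HurwitzMove a b ∨ HurwitzMove b a

/-! ### The geometric representation -/

namespace CoxeterMatrix

variable {B : Type*} (M : CoxeterMatrix B)

/-- The linear form `v ↦ 2 B(e_i, v)` of the geometric representation. -/
noncomputable def geomCoroot (i : B) : Module.Dual ℝ (B →₀ ℝ) :=
  Finsupp.linearCombination ℝ fun j => -2 * Real.cos (Real.pi / M i j)

theorem geomCoroot_single (i j : B) :
    M.geomCoroot i (Finsupp.single j 1) = -2 * Real.cos (Real.pi / M i j) := by
  simp [geomCoroot]

theorem geomCoroot_self (i : B) : M.geomCoroot i (Finsupp.single i 1) = 2 := by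
  simp [geomCoroot_single]

/-- The reflection by which the generator `i` acts in the geometric representation. -/
noncomputable def geomReflection (i : B) : (B →₀ ℝ) ≃ₗ[ℝ] (B →₀ ℝ) :=
  Module.reflection (M.geomCoroot_self i)

theorem geomReflection_apply (i : B) (v : B →₀ ℝ) :
    M.geomReflection i v = v - M.geomCoroot i v • Finsupp.single i 1 :=
  Module.reflection_apply _ _

open Polynomial.Chebyshev in
theorem eval_S_two_mul_cos_eq {m : ℕ} (hm : 3 ≤ m) :
    ((S ℝ (((m : ℤ) - 2) / 2)).eval (2 * Real.cos (2 * (Real.pi / m))) *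
      ((S ℝ (((m : ℤ) - 1) / 2)).eval (2 * Real.cos (2 * (Real.pi / m))) +
        (S ℝ (((m : ℤ) - 3) / 2)).eval (2 * Real.cos (2 * (Real.pi / m)))) = 0) ∧
    ((S ℝ (((m : ℤ) - 1) / 2)).eval (2 * Real.cos (2 * (Real.pi / m))) *
      ((S ℝ ((m : ℤ) / 2)).eval (2 * Real.cos (2 * (Real.pi / m))) +
        (S ℝ (((m : ℤ) - 2) / 2)).eval (2 * Real.cos (2 * (Real.pi / m)))) = 0) := by
  set θ := 2 * (Real.pi / m) with hθ
  have hm0 : (m : ℝ) ≠ 0 := by positivity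
  have hmθ : m * θ = 2 * Real.pi := by rw [hθ]; field_simp
  have hm3 : (3 : ℝ) ≤ m := by exact_mod_cast hm
  have hs : Real.sin θ ≠ 0 := by
    refine (Real.sin_pos_of_pos_of_lt_pi (by positivity) ?_).ne'
    nlinarith [Real.pi_pos]
  have hS (n : ℤ) := S_two_mul_real_cos θ n
  obtain ⟨k, rfl | rfl⟩ := m.even_or_odd'
  · have hk : (k : ℝ) * θ = Real.pi := by push_cast at hmθ; linarith
    have h0 : (S ℝ ((k : ℤ) - 1)).eval (2 * Real.cos θ) = 0 := by
      have := hS (k - 1)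
      simp only [Int.cast_sub, Int.cast_natCast, Int.cast_one, sub_add_cancel, hk,
        Real.sin_pi] at this
      exact (mul_eq_zero.mp this).resolve_right hs
    rw [show ((2 * k : ℕ) - 2 : ℤ) / 2 = k - 1 by omega,
      show ((2 * k : ℕ) - 1 : ℤ) / 2 = k - 1 by omega, h0]
    simp
  · have hk : ((k : ℝ) + 1) * θ = 2 * Real.pi - k * θ := by push_cast at hmθ; linarith
    have h0 : (S ℝ (k : ℤ)).eval (2 * Real.cos θ) +
        (S ℝ ((k : ℤ) - 1)).eval (2 * Real.cos θ) = 0 := by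
      have h1 := hS k
      have h2 := hS (k - 1)
      simp only [Int.cast_sub, Int.cast_natCast, Int.cast_one, sub_add_cancel, hk,
        Real.sin_two_pi_sub] at h1 h2
      refine (mul_eq_zero.mp (?_ : _ * Real.sin θ = 0)).resolve_right hs
      rw [add_mul, h1, h2, neg_add_cancel]
    rw [show ((2 * k + 1 : ℕ) - 2 : ℤ) / 2 = k - 1 by omega,
      show ((2 * k + 1 : ℕ) - 1 : ℤ) / 2 = k by omega,
      show ((2 * k + 1 : ℕ) - 3 : ℤ) / 2 = k - 1 by omega,
      show ((2 * k + 1 : ℕ) : ℤ) / 2 = k by omega, h0]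
    simp

theorem isLiftable_geomReflection : M.IsLiftable M.geomReflection := by
  intro i j
  by_cases hij : i = j
  · subst hij
    rw [M.diagonal, pow_one]
    exact LinearEquiv.ext fun v => Module.involutive_reflection (M.geomCoroot_self i) v
  refine LinearEquiv.ext fun z => ?_
  rw [geomReflection, geomReflection, Module.reflection_mul_reflection_pow_apply]
  simp only [geomCoroot_single, M.symmetric j i, LinearEquiv.coe_one, id_eq]
  have h1 : M i j ≠ 1 := M.off_diagonal i j hij
  rcases (by omega : M i j = 0 ∨ M i j = 2 ∨ 3 ≤ M i j) with h | h | h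
  · simp [h]
  · simp [h]
    module
  · rw [show -2 * Real.cos (Real.pi / M i j) * (-2 * Real.cos (Real.pi / M i j)) - 2 =
      2 * Real.cos (2 * (Real.pi / M i j)) by rw [Real.cos_two_mul]; ring,
      (eval_S_two_mul_cos_eq h).1, (eval_S_two_mul_cos_eq h).2]
    simp

end CoxeterMatrix

namespace CoxeterSystem

variable {B W : Type*} [Group W] {M : CoxeterMatrix B} (cs : CoxeterSystem M W)

/-- The geometric representation of a Coxeter group. -/
noncomputable def geomRep : W →* ((B →₀ ℝ) ≃ₗ[ℝ] (B →₀ ℝ)) :=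
  cs.lift ⟨M.geomReflection, M.isLiftable_geomReflection⟩

theorem geomRep_wordProd_apply_of_notMem {i : B} {l : List B} (h : i ∉ l) (v : B →₀ ℝ) :
    cs.geomRep (cs.wordProd l) v i = v i := by
  induction l with
  | nil => simp
  | cons j l ih =>
    rw [List.mem_cons, not_or] at h
    rw [wordProd_cons, map_mul, LinearEquiv.mul_apply, geomRep, lift_apply_simple,
      M.geomReflection_apply, Finsupp.sub_apply, Finsupp.smul_apply,
      Finsupp.single_eq_of_ne h.1, smul_zero, sub_zero]
    exact ih h.2

theorem wordProd_ne_one_of_nodup {l : List B} (hl : l.Nodup) (hne : l ≠ []) :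
    cs.wordProd l ≠ 1 := by
  intro h
  obtain ⟨l, i, rfl⟩ := List.eq_nil_or_concat l |>.resolve_left hne
  have hi : i ∉ l := by
    intro hi
    exact (List.nodup_append.mp (List.concat_eq_append ▸ hl)).2.2 i hi i (by simp) rfl
  have h1 := geomRep_wordProd_apply_of_notMem cs hi
    (cs.geomRep (cs.simple i) (Finsupp.single i 1))
  rw [← LinearEquiv.mul_apply, ← map_mul, ← wordProd_concat, h, map_one,
    geomRep, lift_apply_simple, M.geomReflection_apply, M.geomCoroot_self] at h1
  simp at h1
  norm_num at h1

/-! ### The reflection cocycle and the strong exchange property -/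

open Classical in
/-- The action of a simple reflection `s` on pairs of an element `t` and a sign: conjugate `t`
by `s` and flip the sign if `t = s`. -/
noncomputable def signedConj (i : B) : Function.End (W × ZMod 2) :=
  fun p => (cs.simple i * p.1 * cs.simple i, p.2 + if p.1 = cs.simple i then 1 else 0)

open Classical in
theorem signedConj_mul_pow_apply (i j : B) (n : ℕ) (p : W × ZMod 2) :
    (cs.signedConj i * cs.signedConj j) ^ n • p =
      ((cs.simple i * cs.simple j) ^ n * p.1 * (cs.simple j * cs.simple i) ^ n,
        p.2 + ∑ k ∈ Finset.range (2 * n),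
          if p.1 = (cs.simple j * cs.simple i) ^ k * cs.simple j then 1 else 0) := by
  induction n with
  | zero => simp
  | succ n ih =>
    have hinv : ((cs.simple i * cs.simple j) ^ n)⁻¹ = (cs.simple j * cs.simple i) ^ n := by
      rw [← inv_pow, mul_inv_rev, inv_simple, inv_simple]
    have hconj (k : ℕ) : cs.simple j * (cs.simple i * cs.simple j) ^ k =
        (cs.simple j * cs.simple i) ^ k * cs.simple j := by
      induction k with
      | zero => simp
      | succ k ih => rw [pow_succ, ← mul_assoc, ih, pow_succ]; simp only [mul_assoc]
    have key (u : W) : (cs.simple i * cs.simple j) ^ n * p.1 * (cs.simple j * cs.simple i) ^ n = u ↔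
        p.1 = (cs.simple j * cs.simple i) ^ n * u * (cs.simple i * cs.simple j) ^ n := by
      rw [← hinv]
      constructor
      · rintro rfl; group
      · intro h; rw [h]; group
    rw [pow_succ', mul_smul, ih, show 2 * (n + 1) = 2 * n + 1 + 1 by ring, Finset.sum_range_succ,
      Finset.sum_range_succ]
    have e1 : ((cs.simple i * cs.simple j) ^ n * p.1 * (cs.simple j * cs.simple i) ^ n =
        cs.simple j) ↔ p.1 = (cs.simple j * cs.simple i) ^ (2 * n) * cs.simple j := by
      rw [key, mul_assoc, hconj, ← mul_assoc, ← pow_add, two_mul]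
    have e2 : (cs.simple j * ((cs.simple i * cs.simple j) ^ n * p.1 *
        (cs.simple j * cs.simple i) ^ n) * cs.simple j = cs.simple i) ↔
        p.1 = (cs.simple j * cs.simple i) ^ (2 * n + 1) * cs.simple j := by
      have : cs.simple j * ((cs.simple i * cs.simple j) ^ n * p.1 *
          (cs.simple j * cs.simple i) ^ n) * cs.simple j = cs.simple i ↔
          (cs.simple i * cs.simple j) ^ n * p.1 * (cs.simple j * cs.simple i) ^ n =
            cs.simple j * cs.simple i * cs.simple j := by
        generalize (cs.simple i * cs.simple j) ^ n * p.1 * (cs.simple j * cs.simple i) ^ n = x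
        generalize cs.simple i = y
        constructor
        · intro h
          subst h
          simp [mul_assoc]
        · rintro rfl
          simp [mul_assoc]
      rw [this, key, mul_assoc, mul_assoc, hconj, ← mul_assoc, ← mul_assoc]
      rw [show 2 * n + 1 = n + 1 + n by ring, pow_add, pow_succ]
    change cs.signedConj i (cs.signedConj j _) = _
    simp only [signedConj, e1, e2]
    refine Prod.ext ?_ ?_
    · simp only [pow_succ' (cs.simple i * cs.simple j), pow_succ (cs.simple j * cs.simple i),
        mul_assoc]
    · simp only [add_assoc]

open Classical in
theorem isLiftable_signedConj : M.IsLiftable cs.signedConj := by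
  intro i j
  funext p
  change (cs.signedConj i * cs.signedConj j) ^ M i j • p = p
  have h₁ := cs.simple_mul_simple_pow i j
  have h₂ := cs.simple_mul_simple_pow' i j
  generalize M i j = m at h₁ h₂ ⊢
  rw [signedConj_mul_pow_apply, two_mul, Finset.sum_range_add]
  simp only [pow_add, h₁, h₂, CharTwo.add_self_eq_zero, one_mul, mul_one, add_zero]

/-- The action of `W` on `W × ZMod 2` through `signedConj`. -/
noncomputable def signedConjHom : W →* Function.End (W × ZMod 2) :=
  cs.lift ⟨cs.signedConj, cs.isLiftable_signedConj⟩

/-- The reflection cocycle: for a reflection `t`, it is `1` if `t` is a right inversion of `w`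
and `0` otherwise. -/
noncomputable def reflCocycle (w t : W) : ZMod 2 :=
  (cs.signedConjHom w (t, 0)).2

theorem signedConjHom_apply (w t : W) (ε : ZMod 2) :
    cs.signedConjHom w (t, ε) = (w * t * w⁻¹, ε + cs.reflCocycle w t) := by
  suffices h : ∀ ε, cs.signedConjHom w (t, ε) =
      (w * t * w⁻¹, ε + (cs.signedConjHom w (t, 0)).2) from h ε
  induction w using cs.simple_induction_left with
  | one => intro ε; simp only [map_one]; change (t, ε) = (1 * t * 1⁻¹, ε + 0); simp
  | mul_simple_left w i ih =>
    intro ε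
    have h (p) : cs.signedConjHom (cs.simple i * w) p =
        cs.signedConj i (cs.signedConjHom w p) := by
      rw [map_mul, signedConjHom, lift_apply_simple]; rfl
    rw [h, h, ih, ih 0]
    simp [signedConj, mul_assoc, add_assoc]

theorem reflCocycle_mul (v w t : W) :
    cs.reflCocycle (v * w) t = cs.reflCocycle w t + cs.reflCocycle v (w * t * w⁻¹) := by
  have h : cs.signedConjHom (v * w) (t, 0) = cs.signedConjHom v (cs.signedConjHom w (t, 0)) := by
    rw [map_mul]; rfl
  simpa [signedConjHom_apply] using congrArg Prod.snd h

theorem reflCocycle_one (t : W) : cs.reflCocycle 1 t = 0 := by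
  rw [reflCocycle, map_one]; rfl

open Classical in
theorem reflCocycle_simple (i : B) (t : W) :
    cs.reflCocycle (cs.simple i) t = if t = cs.simple i then 1 else 0 := by
  rw [reflCocycle, signedConjHom, lift_apply_simple]
  simp [signedConj]

variable {cs} in
theorem IsReflection.reflCocycle_self {t : W} (ht : cs.IsReflection t) :
    cs.reflCocycle t t = 1 := by
  obtain ⟨w, i, rfl⟩ := ht
  have h := cs.reflCocycle_mul w w⁻¹ (w * cs.simple i * w⁻¹)
  rw [mul_inv_cancel, reflCocycle_one] at h
  have e : w⁻¹ * (w * cs.simple i * w⁻¹) * w⁻¹⁻¹ = cs.simple i := by group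
  rw [e] at h
  rw [reflCocycle_mul, e, reflCocycle_mul, cs.reflCocycle_simple, if_pos rfl, mul_inv_cancel_right]
  linear_combination -h

/-- If the cocycle is nonzero at `t`, then right multiplication by `t` deletes a letter. -/
theorem exists_of_reflCocycle_ne_zero {ω : List B} {t : W}
    (h : cs.reflCocycle (cs.wordProd ω) t ≠ 0) :
    ∃ (u v : List B) (i : B), ω = u ++ i :: v ∧
      t = (cs.wordProd v)⁻¹ * cs.simple i * cs.wordProd v := by
  induction ω with
  | nil => simp [reflCocycle_one] at h
  | cons j ω ih =>
    by_cases h0 : cs.reflCocycle (cs.wordProd ω) t = 0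
    · rw [wordProd_cons, reflCocycle_mul, h0, zero_add, reflCocycle_simple] at h
      refine ⟨[], ω, j, rfl, ?_⟩
      rw [← (by simpa using h : _ = cs.simple j)]
      group
    · obtain ⟨u, v, i, rfl, rfl⟩ := ih h0
      exact ⟨j :: u, v, i, rfl, rfl⟩

theorem length_mul_lt_of_reflCocycle_ne_zero {w t : W} (h : cs.reflCocycle w t ≠ 0) :
    cs.length (w * t) < cs.length w := by
  obtain ⟨ω, hω, rfl⟩ := cs.exists_isReduced w
  obtain ⟨u, v, i, rfl, rfl⟩ := cs.exists_of_reflCocycle_ne_zero h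
  have e : cs.wordProd (u ++ i :: v) * ((cs.wordProd v)⁻¹ * cs.simple i * cs.wordProd v) =
      cs.wordProd (u ++ v) := by
    simp [wordProd_append, wordProd_cons, mul_assoc]
  rw [e, hω.eq]
  refine (cs.length_wordProd_le _).trans_lt ?_
  simp

variable {cs} in
theorem IsReflection.reflCocycle_ne_zero_iff {t : W} (ht : cs.IsReflection t) (w : W) :
    cs.reflCocycle w t ≠ 0 ↔ cs.length (w * t) < cs.length w := by
  refine ⟨cs.length_mul_lt_of_reflCocycle_ne_zero, fun h h0 => ?_⟩
  have h1 : cs.reflCocycle (w * t) t ≠ 0 := by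
    rw [reflCocycle_mul, ht.reflCocycle_self, mul_inv_cancel_right, h0]
    simp
  have h2 := cs.length_mul_lt_of_reflCocycle_ne_zero h1
  rw [mul_assoc, ht.mul_self, mul_one] at h2
  exact lt_asymm h h2

end CoxeterSystem

/-! ### Pairs of reflections -/

section Dihedral

variable {W : Type*} [Group W] {t₁ t₂ : W}

theorem mul_zpow_mul_of_mul_self (h₁ : t₁ * t₁ = 1) (h₂ : t₂ * t₂ = 1) (k : ℤ) :
    t₁ * (t₁ * t₂) ^ k = (t₁ * t₂) ^ (-k) * t₁ := by
  have e : t₁ * (t₁ * t₂) * t₁⁻¹ = (t₁ * t₂)⁻¹ := by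
    rw [mul_inv_rev, inv_eq_of_mul_eq_one_right h₁, inv_eq_of_mul_eq_one_right h₂, ← mul_assoc, h₁,
      one_mul]
  rw [zpow_neg, ← inv_zpow, ← e, conj_zpow]
  group

theorem zpow_mul_mul_zpow_mul_of_mul_self (h₁ : t₁ * t₁ = 1) (h₂ : t₂ * t₂ = 1) (k n : ℤ) :
    (t₁ * t₂) ^ k * t₁ * ((t₁ * t₂) ^ n * t₁) = (t₁ * t₂) ^ (k - n) := by
  rw [← mul_assoc, mul_assoc _ t₁, mul_zpow_mul_of_mul_self h₁ h₂, mul_assoc, mul_assoc, h₁, mul_one,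
    ← zpow_add, sub_eq_add_neg]

theorem mul_zpow_mul_mul_inv_of_mul_self (h₁ : t₁ * t₁ = 1) (h₂ : t₂ * t₂ = 1) (k : ℤ) :
    t₁ * t₂ * ((t₁ * t₂) ^ k * t₁) * (t₁ * t₂)⁻¹ = (t₁ * t₂) ^ (k + 2) * t₁ := by
  rw [← mul_assoc (t₁ * t₂), ← zpow_one_add, mul_assoc, ← zpow_neg_one,
    mul_zpow_mul_of_mul_self h₁ h₂, neg_neg, ← mul_assoc, ← zpow_add]
  ring_nf

end Dihedral

namespace CoxeterSystem

variable {B W : Type*} [Group W] {M : CoxeterMatrix B} {cs : CoxeterSystem M W} {t₁ t₂ : W}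

theorem IsReflection.zpow_mul (h₁ : cs.IsReflection t₁) (h₂ : cs.IsReflection t₂) (k : ℤ) :
    cs.IsReflection ((t₁ * t₂) ^ k * t₁) := by
  have h := mul_zpow_mul_of_mul_self h₁.mul_self h₂.mul_self
  obtain ⟨n, rfl | rfl⟩ := k.even_or_odd'
  · convert h₁.conj ((t₁ * t₂) ^ n) using 1
    rw [← zpow_neg, mul_assoc, h, ← mul_assoc, ← zpow_add]
    ring_nf
  · convert h₂.conj ((t₁ * t₂) ^ (n + 1)) using 1
    have e : t₂ = t₁ * (t₁ * t₂) ^ (1 : ℤ) := by rw [zpow_one, ← mul_assoc, h₁.mul_self, one_mul]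
    conv_rhs => rw [← zpow_neg, mul_assoc]; enter [2, 1]; rw [e]
    rw [mul_assoc, ← zpow_add, h, ← mul_assoc, ← zpow_add]
    ring_nf

theorem IsReflection.reflCocycle_mul_ne_zero_of_zpow_mul_eq_simple (h₁ : cs.IsReflection t₁)
    (h₂ : cs.IsReflection t₂) (hne : t₁ ≠ t₂) {k : ℤ} {i : B}
    (hk : (t₁ * t₂) ^ k * t₁ = cs.simple i) :
    cs.reflCocycle (t₁ * t₂) ((t₁ * t₂) ^ (k - 1) * t₁) ≠ 0 := by
  rw [(h₁.zpow_mul h₂ _).reflCocycle_ne_zero_iff, ← mul_assoc, mul_self_zpow, sub_add_cancel, hk,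
    length_simple]
  have h0 : cs.length (t₁ * t₂) ≠ 0 := by
    rw [Ne, length_eq_zero_iff]
    intro h
    exact hne (by rw [eq_inv_of_mul_eq_one_left h, h₂.inv])
  have h2 := cs.length_mul_mod_two t₁ t₂
  have := Nat.odd_iff.mp h₁.odd_length
  have := Nat.odd_iff.mp h₂.odd_length
  omega

/-- Some reflection of the dihedral group generated by `t₁` and `t₂` is an inversion of
`t₁ * t₂`. -/
theorem IsReflection.exists_reflCocycle_mul_ne_zero (h₁ : cs.IsReflection t₁)
    (h₂ : cs.IsReflection t₂) (hne : t₁ ≠ t₂) :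
    ∃ k : ℤ, cs.reflCocycle (t₁ * t₂) ((t₁ * t₂) ^ k * t₁) ≠ 0 := by
  obtain ⟨w, i, hw⟩ := id h₁
  obtain ⟨ω, rfl⟩ := cs.wordProd_surjective w
  induction ω generalizing t₁ t₂ with
  | nil =>
    exact ⟨0 - 1, h₁.reflCocycle_mul_ne_zero_of_zpow_mul_eq_simple h₂ hne (i := i) (by simpa using hw)⟩
  | cons j ω ih =>
    by_cases hj : ∃ k : ℤ, (t₁ * t₂) ^ k * t₁ = cs.simple j
    · obtain ⟨k, hk⟩ := hj
      exact ⟨_, h₁.reflCocycle_mul_ne_zero_of_zpow_mul_eq_simple h₂ hne hk⟩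
    have hconj (t : W) (ht : cs.IsReflection t) :
        cs.IsReflection (cs.simple j * t * cs.simple j) := by
      simpa using ht.conj (cs.simple j)
    obtain ⟨k, hk⟩ := ih (hconj t₁ h₁) (hconj t₂ h₂) (by simpa using hne)
      (by rw [hw]; simp [wordProd_cons, mul_assoc])
    refine ⟨k, ?_⟩
    have e : cs.simple j * t₁ * cs.simple j * (cs.simple j * t₂ * cs.simple j) =
        cs.simple j * (t₁ * t₂) * (cs.simple j)⁻¹ := by
      simp [mul_assoc]
    rw [e, conj_zpow] at hk
    set ρ := t₁ * t₂ with hρ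
    set r := ρ ^ k * t₁ with hr
    have er : cs.simple j * ρ ^ k * (cs.simple j)⁻¹ * (cs.simple j * t₁ * cs.simple j) =
        cs.simple j * r * (cs.simple j)⁻¹ := by
      simp [mul_assoc, hr]
    have hr1 : r ≠ cs.simple j := fun h => hj ⟨k, h⟩
    have hr2 : ρ * r * ρ⁻¹ ≠ cs.simple j := by
      intro h
      refine hj ⟨k + 2, ?_⟩
      rw [← h, mul_zpow_mul_mul_inv_of_mul_self h₁.mul_self h₂.mul_self]
    have hr3 : cs.simple j * r * (cs.simple j)⁻¹ ≠ cs.simple j := by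
      rwa [Ne, mul_inv_eq_iff_eq_mul, mul_right_inj]
    have e3 : (cs.simple j)⁻¹ * (cs.simple j * r * (cs.simple j)⁻¹) * (cs.simple j)⁻¹⁻¹ = r := by
      group
    rw [er, reflCocycle_mul, reflCocycle_mul, e3, inv_simple, reflCocycle_simple,
      reflCocycle_simple, if_neg hr2] at hk
    rw [inv_simple] at hr3
    rwa [if_neg hr3, zero_add, add_zero] at hk

/-- A peak `x < x t₁ > x t₁ t₂` can be replaced by a path whose middle vertex is shorter than one
of the end points. -/
theorem IsReflection.exists_length_mul_lt (h₁ : cs.IsReflection t₁)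
    (h₂ : cs.IsReflection t₂) (hne : t₁ ≠ t₂) (x : W) :
    ∃ k : ℤ, cs.length (x * ((t₁ * t₂) ^ k * t₁)) < cs.length x ∨
      cs.length (x * ((t₁ * t₂) ^ k * t₁)) < cs.length (x * (t₁ * t₂)) := by
  obtain ⟨k, hk⟩ := h₁.exists_reflCocycle_mul_ne_zero h₂ hne
  by_cases hx : cs.reflCocycle x ((t₁ * t₂) * ((t₁ * t₂) ^ k * t₁) * (t₁ * t₂)⁻¹) = 0
  · refine ⟨k + 1, Or.inr ?_⟩
    have h : cs.reflCocycle (x * (t₁ * t₂)) ((t₁ * t₂) ^ k * t₁) ≠ 0 := by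
      rwa [reflCocycle_mul, hx, add_zero]
    convert cs.length_mul_lt_of_reflCocycle_ne_zero h using 2
    rw [add_comm k, zpow_one_add]
    simp only [mul_assoc]
  · refine ⟨k + 2, Or.inl ?_⟩
    convert cs.length_mul_lt_of_reflCocycle_ne_zero hx using 3
    rw [mul_zpow_mul_mul_inv_of_mul_self h₁.mul_self h₂.mul_self]

end CoxeterSystem

/-! ### Hurwitz equivalence -/

namespace HurwitzEquiv

variable {W : Type*} [Group W] {a b c : List W}

theorem refl (a : List W) : HurwitzEquiv a a := Relation.ReflTransGen.refl

theorem trans (h₁ : HurwitzEquiv a b) (h₂ : HurwitzEquiv b c) : HurwitzEquiv a c :=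
  Relation.ReflTransGen.trans h₁ h₂

theorem symm (h : HurwitzEquiv a b) : HurwitzEquiv b a :=
  have : Std.Symm fun a b : List W => HurwitzMove a b ∨ HurwitzMove b a := ⟨fun _ _ => Or.symm⟩
  Relation.ReflTransGen.stdSymm.symm _ _ h

theorem of_move (h : HurwitzMove a b) : HurwitzEquiv a b :=
  Relation.ReflTransGen.single (Or.inl h)

/-- A property that is invariant under Hurwitz moves is invariant under Hurwitz equivalence. -/
theorem iff_of_move {p : List W → Prop} (hp : ∀ a b, HurwitzMove a b → (p a ↔ p b))
    (h : HurwitzEquiv a b) : p a ↔ p b := by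
  induction h with
  | refl => rfl
  | tail _ h ih => exact ih.trans (h.elim (hp _ _) fun h => (hp _ _ h).symm)

theorem append_append (h : HurwitzEquiv a b) (u v : List W) :
    HurwitzEquiv (u ++ a ++ v) (u ++ b ++ v) := by
  refine Relation.ReflTransGen.lift (fun l => u ++ l ++ v) (fun a b h => ?_) _ _ h
  refine h.imp ?_ ?_ <;>
  · rintro ⟨l₁, l₂, t, t', rfl, rfl⟩
    exact ⟨u ++ l₁, l₂ ++ v, t, t', by simp, by simp⟩

theorem length_eq (h : HurwitzEquiv a b) : a.length = b.length := by
  refine (h.iff_of_move (p := fun l => a.length = l.length) ?_).mp rfl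
  rintro _ _ ⟨l₁, l₂, t, t', rfl, rfl⟩
  simp

theorem prod_eq (h : HurwitzEquiv a b) : a.prod = b.prod := by
  refine (h.iff_of_move (p := fun l => a.prod = l.prod) ?_).mp rfl
  rintro _ _ ⟨l₁, l₂, t, t', rfl, rfl⟩
  simp [mul_assoc]

theorem isReflection {B : Type*} {M : CoxeterMatrix B} {cs : CoxeterSystem M W}
    (h : HurwitzEquiv a b) (ha : ∀ t ∈ a, cs.IsReflection t) : ∀ t ∈ b, cs.IsReflection t := by
  refine (h.iff_of_move (p := fun l => ∀ t ∈ l, cs.IsReflection t) ?_).mp ha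
  rintro _ _ ⟨l₁, l₂, t, t', rfl, rfl⟩
  simp only [List.mem_append, List.mem_cons, or_imp, forall_and, forall_eq,
    CoxeterSystem.isReflection_conj_iff]
  tauto

/-- An entry can be moved to the end, where it gets conjugated by the entries it passes. -/
theorem cons_append_conj (s : W) (v : List W) :
    HurwitzEquiv (s :: v) (v ++ [v.prod⁻¹ * s * v.prod]) := by
  induction v generalizing s with
  | nil => simpa using refl [s]
  | cons a v ih =>
    have h : HurwitzMove (a :: (a⁻¹ * s * a) :: v) (s :: a :: v) :=
      ⟨[], v, a, a⁻¹ * s * a, rfl, by simp [mul_assoc]⟩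
    refine (of_move h).symm.trans ?_
    simpa [mul_assoc] using (ih (a⁻¹ * s * a)).append_append [a] []

theorem pair_zpow_mul {t₁ t₂ : W} (h₁ : t₁ * t₁ = 1) (h₂ : t₂ * t₂ = 1) (k : ℤ) :
    HurwitzEquiv [t₁, t₂] [(t₁ * t₂) ^ k * t₁, (t₁ * t₂) ^ (k - 1) * t₁] := by
  have hmove (n : ℤ) : HurwitzMove [(t₁ * t₂) ^ n * t₁, (t₁ * t₂) ^ (n - 1) * t₁]
      [(t₁ * t₂) ^ (n + 1) * t₁, (t₁ * t₂) ^ (n + 1 - 1) * t₁] := by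
    refine ⟨[], [], (t₁ * t₂) ^ n * t₁, (t₁ * t₂) ^ (n - 1) * t₁, rfl, ?_⟩
    have hmul := zpow_mul_mul_zpow_mul_of_mul_self h₁ h₂
    have hinv : ((t₁ * t₂) ^ n * t₁)⁻¹ = (t₁ * t₂) ^ n * t₁ :=
      inv_eq_of_mul_eq_one_right (by rw [hmul, sub_self, zpow_zero])
    rw [hinv, hmul, ← mul_assoc, ← zpow_add]
    simp only [List.nil_append]
    ring_nf
  induction k with
  | zero =>
    have e : (t₁ * t₂) ^ (0 - 1 : ℤ) * t₁ = t₂ := by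
      rw [zero_sub, zpow_neg_one, mul_inv_rev, inv_mul_cancel_right,
        inv_eq_of_mul_eq_one_right h₂]
    rw [e, zpow_zero, one_mul]
    exact refl _
  | succ n ih => exact ih.trans (of_move (hmove _))
  | pred n ih =>
    refine ih.trans (symm ?_)
    have := of_move (hmove (-n - 1))
    rwa [sub_add_cancel] at this

end HurwitzEquiv

/-! ### Ascending factorizations -/

/-- The sum of the lengths of the elements `x t₁`, `x t₁ t₂`, … along the path that starts at `x`
and has labels `l`. -/
noncomputable def pathLengthSum {B W : Type*} [Group W] {M : CoxeterMatrix B}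
    (cs : CoxeterSystem M W) : W → List W → ℕ
  | _, [] => 0
  | x, t :: l => cs.length (x * t) + pathLengthSum cs (x * t) l

theorem pathLengthSum_append {B W : Type*} [Group W] {M : CoxeterMatrix B}
    (cs : CoxeterSystem M W) (x : W) (a b : List W) :
    pathLengthSum cs x (a ++ b) = pathLengthSum cs x a + pathLengthSum cs (x * a.prod) b := by
  induction a generalizing x with
  | nil => simp [pathLengthSum]
  | cons t a ih => simp [pathLengthSum, ih, add_assoc, mul_assoc]

/-- The length increases along the path from `1` with labels `l`. -/
def IsAscending {B W : Type*} [Group W] {M : CoxeterMatrix B}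
    (cs : CoxeterSystem M W) (l : List W) : Prop :=
  ∀ (a : List W) (t : W) (b : List W), l = a ++ t :: b →
    cs.length a.prod < cs.length (a.prod * t)

section

variable {B W : Type*} [Group W] {M : CoxeterMatrix B} {cs : CoxeterSystem M W}

/-- A path from `1` without peaks is ascending. -/
theorem exists_peak_of_not_isAscending {l : List W} (hl : ∀ t ∈ l, cs.IsReflection t)
    (h : ¬ IsAscending cs l) :
    ∃ (a b : List W) (t₁ t₂ : W), l = a ++ t₁ :: t₂ :: b ∧
      cs.length a.prod < cs.length (a.prod * t₁) ∧
      cs.length (a.prod * (t₁ * t₂)) < cs.length (a.prod * t₁) := by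
  contrapose! h
  intro a
  induction a using List.reverseRecOn with
  | nil =>
    rintro t b rfl
    have := (hl t (by simp)).odd_length.pos
    simpa using this
  | append_singleton a s ih =>
    intro t b hab
    have e : l = a ++ s :: t :: b := by simpa using hab
    have h1 := h a b s t e (ih s _ e)
    have h2 := (hl t (by simp [e])).length_mul_left_ne (a.prod * s)
    rw [List.prod_append, List.prod_singleton]
    rw [← mul_assoc] at h1
    exact lt_of_le_of_ne h1 h2.symm

theorem RedT_of_hurwitzEquiv {c : W} {l l' : List W} (h : HurwitzEquiv l l') (hl : l ∈ RedT cs c) :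
    l' ∈ RedT cs c :=
  ⟨h.length_eq ▸ hl.1, h.isReflection hl.2.1, h.prod_eq ▸ hl.2.2⟩

theorem ne_of_append_mem_RedT {c : W} {a b : List W} {t₁ t₂ : W}
    (h : a ++ t₁ :: t₂ :: b ∈ RedT cs c) : t₁ ≠ t₂ := by
  rintro rfl
  obtain ⟨hlen, hrefl, hprod⟩ := h
  have ht : t₁ * t₁ = 1 := (hrefl t₁ (by simp)).mul_self
  have : reflLen cs c ≤ (a ++ b).length := by
    refine Nat.sInf_le ⟨a ++ b, rfl, fun t ht => hrefl t ?_, ?_⟩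
    · simp only [List.mem_append, List.mem_cons] at ht ⊢
      tauto
    · rw [← hprod]
      simp only [List.prod_append, List.prod_cons]
      rw [← mul_assoc t₁, ht, one_mul]
  simp at hlen this
  omega

theorem exists_hurwitzEquiv_isAscending {c : W} {l : List W} (hl : l ∈ RedT cs c) :
    ∃ l', HurwitzEquiv l l' ∧ IsAscending cs l' := by
  induction hn : pathLengthSum cs 1 l using Nat.strong_induction_on generalizing l with
  | _ n ih =>
    by_cases hasc : IsAscending cs l
    · exact ⟨l, .refl l, hasc⟩
    obtain ⟨a, b, t₁, t₂, rfl, hup, hdown⟩ := exists_peak_of_not_isAscending hl.2.1 hasc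
    have h₁ : cs.IsReflection t₁ := hl.2.1 t₁ (by simp)
    have h₂ : cs.IsReflection t₂ := hl.2.1 t₂ (by simp)
    obtain ⟨k, hk⟩ := h₁.exists_length_mul_lt h₂ (ne_of_append_mem_RedT hl) a.prod
    have heq := (HurwitzEquiv.pair_zpow_mul h₁.mul_self h₂.mul_self k).append_append a b
    have hprod := zpow_mul_mul_zpow_mul_of_mul_self h₁.mul_self h₂.mul_self k (k - 1)
    rw [sub_sub_cancel, zpow_one] at hprod
    simp only [List.append_assoc, List.cons_append, List.nil_append] at heq
    have hlt : pathLengthSum cs 1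
        (a ++ ((t₁ * t₂) ^ k * t₁) :: ((t₁ * t₂) ^ (k - 1) * t₁) :: b) < n := by
      rw [← hn]
      simp only [pathLengthSum_append, pathLengthSum, one_mul, mul_assoc a.prod, hprod]
      omega
    obtain ⟨l', hl', hasc'⟩ := ih _ hlt (RedT_of_hurwitzEquiv heq hl) rfl
    exact ⟨l', heq.trans hl', hasc'⟩

/-- An ascending factorization of a product of distinct simple reflections is Hurwitz equivalent
to that product. -/
theorem IsAscending.hurwitzEquiv {l : List B} (hl : l.Nodup) {L : List W}
    (hL : ∀ t ∈ L, cs.IsReflection t) (hprod : L.prod = cs.wordProd l) (hasc : IsAscending cs L) :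
    HurwitzEquiv L (l.map cs.simple) := by
  induction L using List.reverseRecOn generalizing l with
  | nil =>
    by_cases h : l = []
    · subst h; exact .refl _
    · exact absurd hprod.symm (cs.wordProd_ne_one_of_nodup hl h)
  | append_singleton L t ih =>
    have ht : cs.IsReflection t := hL t (by simp)
    have hlt := hasc L t [] rfl
    rw [List.prod_append, List.prod_singleton] at hprod
    have hLt : L.prod = cs.wordProd l * t := by rw [← hprod, mul_assoc, ht.mul_self, mul_one]
    rw [hprod, hLt, ← ht.reflCocycle_ne_zero_iff] at hlt
    obtain ⟨u, v, i, rfl, rfl⟩ := cs.exists_of_reflCocycle_ne_zero hlt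
    have key : HurwitzEquiv L ((u ++ v).map cs.simple) := by
      refine ih (hl.sublist (by simp)) (fun t ht => hL t (by simp [ht])) ?_ fun a s b h => ?_
      · rw [hLt]
        simp [CoxeterSystem.wordProd_append, CoxeterSystem.wordProd_cons, mul_assoc]
      · exact hasc a s (b ++ [(cs.wordProd v)⁻¹ * cs.simple i * cs.wordProd v]) (by simp [h])
    refine (key.append_append [] [(cs.wordProd v)⁻¹ * cs.simple i * cs.wordProd v]).trans ?_
    simpa [CoxeterSystem.wordProd] using
      ((HurwitzEquiv.cons_append_conj (cs.simple i) (v.map cs.simple)).symm.append_append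
        (u.map cs.simple) [])

end

/-- Let `(W, S)` be a Coxeter system of finite rank and let `c = s₁ ⋯ s_m` be a product
of pairwise distinct simple reflections (a parabolic standard Coxeter element).  Then
`ℓ_T (c) = m` and the Hurwitz action of the braid group on `m` strands is transitive on
`Red_T (c)`: any two reduced reflection factorizations of `c` are connected by Hurwitz
moves and their inverses. -/
theorem hurwitz_transitive_parabolic_coxeter_element
    {B W : Type*} [Finite B] [Group W] {M : CoxeterMatrix B} (cs : CoxeterSystem M W)
    (l : List B) (hl : l.Nodup) (c : W) (hc : c = (l.map cs.simple).prod) :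
    reflLen cs c = l.length ∧
    ∀ l₁ ∈ RedT cs c, ∀ l₂ ∈ RedT cs c, HurwitzEquiv l₁ l₂ := by
  have key : ∀ L ∈ RedT cs c, HurwitzEquiv L (l.map cs.simple) := by
    intro L hL
    obtain ⟨L', h, hasc⟩ := exists_hurwitzEquiv_isAscending hL
    have hL' := RedT_of_hurwitzEquiv h hL
    exact h.trans (hasc.hurwitzEquiv hl hL'.2.1 (hL'.2.2.trans hc))
  refine ⟨?_, fun l₁ h₁ l₂ h₂ => (key l₁ h₁).trans (key l₂ h₂).symm⟩
  have hne : {k | ∃ L : List W, L.length = k ∧ (∀ t ∈ L, cs.IsReflection t) ∧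
      L.prod = c}.Nonempty := by
    refine ⟨_, l.map cs.simple, rfl, fun t ht => ?_, hc.symm⟩
    obtain ⟨i, -, rfl⟩ := List.mem_map.mp ht
    exact cs.isReflection_simple i
  obtain ⟨L, hL⟩ := Nat.sInf_mem hne
  exact (hL.1.symm.trans (key L hL).length_eq).trans (List.length_map _)
end
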